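/- arXiv:2207.03165 — 3 statements merged into one kernel-verified Lean document; each statement's English description precedes it below -/
import Mathlib

section
/- Suppose k, l are natural numbers such that k ≥ 2 is even, l ≥ 12, 3 divides l, and l is even. Then (2/3)kl ≤ n(k,l) ≤ (2/3)kl + 1; that is, every element of A_{2kl/3} can be written as a product of k many l-cycles of S_{2kl/3}, and for every n > (2kl/3)+1 there exists an element of A_n that cannot be written as a product of k many l-cycles of S_n. -/
open Equiv

/-- `σ ∈ S_n` is a product of `k` many `l`-cycles. -/
def IsProdOfCycles (n k l : ℕ) (σ : Equiv.Perm (Fin n)) : Prop :=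
  ∃ c : Fin k → Equiv.Perm (Fin n),
    (∀ i, (c i).IsCycle ∧ (c i).support.card = l) ∧ σ = (List.ofFn c).prod

set_option linter.unusedSectionVars false

section Upper
variable {α : Type*} [Fintype α] [DecidableEq α]

def FxP (g : Perm α) : Submodule ℚ (α → ℚ) where
  carrier := {f | ∀ x, f (g x) = f x}
  add_mem' := by intro a b ha hb x; simp [ha x, hb x]
  zero_mem' := by intro x; simp
  smul_mem' := by intro c a ha x; simp [ha x]

def FxL (T : List (α × α)) : Submodule ℚ (α → ℚ) where
  carrier := {f | ∀ p ∈ T, f p.1 = f p.2}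
  add_mem' := by intro a b ha hb x hx; simp [ha x hx, hb x hx]
  zero_mem' := by intro x; simp
  smul_mem' := by intro c a ha x hx; simp [ha x hx]

def FxE (a b : α) : Submodule ℚ (α → ℚ) :=
  LinearMap.ker (LinearMap.proj (R := ℚ) (φ := fun _ : α => ℚ) a - LinearMap.proj b)

lemma mem_FxE (a b : α) (f : α → ℚ) : f ∈ FxE a b ↔ f a = f b := by
  simp [FxE, sub_eq_zero]

def swProd (T : List (α × α)) : Perm α := (T.map (fun p => swap p.1 p.2)).prod

lemma finrank_inf_FxE (X : Submodule ℚ (α → ℚ)) (a b : α) :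
    Module.finrank ℚ X ≤ Module.finrank ℚ (X ⊓ FxE a b : Submodule ℚ (α → ℚ)) + 1 := by
  have h1 := Submodule.finrank_sup_add_finrank_inf_eq X (FxE a b)
  have h2 := Submodule.finrank_le (X ⊔ FxE a b)
  have h3 := LinearMap.finrank_range_add_finrank_ker
    (LinearMap.proj (R := ℚ) (φ := fun _ : α => ℚ) a - LinearMap.proj b)
  have h4 := Submodule.finrank_le (LinearMap.range
    (LinearMap.proj (R := ℚ) (φ := fun _ : α => ℚ) a - LinearMap.proj b))
  have h5 : Module.finrank ℚ ℚ = 1 := Module.finrank_self ℚ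
  unfold FxE at *
  omega

lemma FxP_inf (a b : α) (g : Perm α) : FxP (swap a b * g) ⊓ FxE a b = FxP g ⊓ FxE a b := by
  ext f
  simp only [Submodule.mem_inf, mem_FxE]
  refine and_congr_left fun h => ?_
  have : ∀ y, f (swap a b y) = f y := by
    intro y
    rw [swap_apply_def]; split_ifs with h1 h2 <;> simp_all
  show (∀ x, f ((swap a b * g) x) = f x) ↔ ∀ x, f (g x) = f x
  simp [this]

lemma FxL_le_FxP (T : List (α × α)) : FxL T ≤ FxP (swProd T) := by
  induction T with
  | nil => intro f _ x; simp [swProd]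
  | cons p T ih =>
    intro f hf
    have hf1 : f p.1 = f p.2 := hf p (by simp)
    have hf2 : f ∈ FxL T := fun q hq => hf q (by simp [hq])
    have : f ∈ FxP (swap p.1 p.2 * swProd T) ⊓ FxE p.1 p.2 := by
      rw [FxP_inf]; exact ⟨ih hf2, (mem_FxE _ _ _).2 hf1⟩
    simpa [swProd] using this.1

lemma FxL_cons (p : α × α) (T : List (α × α)) : FxL (p :: T) = FxL T ⊓ FxE p.1 p.2 := by
  ext f
  simp only [Submodule.mem_inf, mem_FxE]
  show (∀ q ∈ p :: T, f q.1 = f q.2) ↔ (∀ q ∈ T, f q.1 = f q.2) ∧ _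
  simp [and_comm]

lemma FxP_le_FxE (a b : α) (g : Perm α) (h : ¬ FxP g ≤ FxE a b) :
    FxP (swap a b * g) ≤ FxE a b := by
  obtain ⟨f0, hf0, hne⟩ := Set.not_subset.1 h
  have hne : f0 a ≠ f0 b := fun h => hne ((mem_FxE _ _ _).2 h)
  intro f hf
  rw [mem_FxE]
  by_contra hab
  have h1 : ∑ x, f0 x * f (g x) = ∑ x, f0 x * f x := by
    rw [← Equiv.sum_comp g (fun x => f0 x * f x)]
    exact Finset.sum_congr rfl fun x _ => by rw [hf0 x]
  have h2 : ∀ x, f x = f (g x) - (f a - f b) * ((if g x = a then 1 else 0) - (if g x = b then 1 else 0)) := by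
    intro x
    rw [← hf x]
    simp only [Perm.mul_apply]
    have hn : a ≠ b := by rintro rfl; exact hab rfl
    rw [swap_apply_def]; split_ifs <;> simp_all
  have h3 : ∑ x, f0 x * f x = ∑ x, f0 x * f (g x) - (f a - f b) * (f0 a - f0 b) := by
    have : ∑ x, f0 (g x) * ((if g x = a then 1 else 0) - (if g x = b then (1:ℚ) else 0)) = f0 a - f0 b := by
      rw [Equiv.sum_comp g (fun y => f0 y * ((if y = a then 1 else 0) - (if y = b then (1:ℚ) else 0)))]
      simp [mul_sub]
    rw [← this, Finset.mul_sum, ← Finset.sum_sub_distrib]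
    refine Finset.sum_congr rfl fun x _ => ?_
    rw [hf0 x]
    conv_lhs => rw [h2 x]
    ring
  have h4 : (f a - f b) * (f0 a - f0 b) = 0 := by linarith
  rcases mul_eq_zero.1 h4 with h | h
  · exact hab (sub_eq_zero.1 h)
  · exact hne (sub_eq_zero.1 h)

lemma ree_ineq (T : List (α × α)) :
    Module.finrank ℚ (FxP (swProd T)) + Fintype.card α ≤ T.length + 2 * Module.finrank ℚ (FxL T) := by
  induction T with
  | nil =>
    have : FxL ([] : List (α × α)) = ⊤ := by
      ext f; simp only [Submodule.mem_top, iff_true]; intro p hp; simp at hp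
    have h2 := Submodule.finrank_le (FxP (swProd ([] : List (α × α))))
    rw [this]
    simp at *
    omega
  | cons p T ih =>
    have hsw : swProd (p :: T) = swap p.1 p.2 * swProd T := by simp [swProd]
    rw [hsw, FxL_cons]
    set g := swProd T with hg
    have e := FxP_inf p.1 p.2 g
    have a1 := finrank_inf_FxE (FxP (swap p.1 p.2 * g)) p.1 p.2
    have a2 := finrank_inf_FxE (FxL T) p.1 p.2
    simp only [List.length_cons]
    by_cases h : FxL T ≤ FxE p.1 p.2
    · rw [inf_eq_left.2 h]
      rw [e] at a1
      have := Submodule.finrank_mono (inf_le_left : FxP g ⊓ FxE p.1 p.2 ≤ FxP g)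
      omega
    · have h' : ¬ FxP g ≤ FxE p.1 p.2 := fun h' => h ((FxL_le_FxP T).trans h')
      have h3 := FxP_le_FxE _ _ _ h'
      rw [inf_eq_left.2 h3] at e
      rw [e]
      have : Module.finrank ℚ (FxP g ⊓ FxE p.1 p.2 : Submodule ℚ (α → ℚ)) < Module.finrank ℚ (FxP g) :=
        Submodule.finrank_lt_finrank_of_lt (inf_lt_left.2 h')
      omega

lemma finrank_FxP_ge (T : List (α × α)) :
    Fintype.card α ≤ Module.finrank ℚ (FxP (swProd T)) + T.length := by
  induction T with
  | nil =>
    have : FxP (swProd ([] : List (α × α))) = ⊤ := by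
      ext f; simp only [Submodule.mem_top, iff_true]; intro x; simp [swProd]
    rw [this]; simp
  | cons p T ih =>
    have hsw : swProd (p :: T) = swap p.1 p.2 * swProd T := by simp [swProd]
    rw [hsw]
    set g := swProd T with hg
    have e := FxP_inf p.1 p.2 g
    have a1 := finrank_inf_FxE (FxP g) p.1 p.2
    have := Submodule.finrank_mono (inf_le_left : FxP (swap p.1 p.2 * g) ⊓ FxE p.1 p.2 ≤ _)
    rw [e] at this
    simp only [List.length_cons]
    omega

lemma formPerm_swaps (L : List α) (hL : L ≠ []) :
    ∃ T : List (α × α), swProd T = L.formPerm ∧ T.length + 1 = L.length := by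
  induction L with
  | nil => exact absurd rfl hL
  | cons x L ih =>
    cases L with
    | nil => exact ⟨[], by simp [swProd]⟩
    | cons y L =>
      obtain ⟨T, h1, h2⟩ := ih (by simp)
      refine ⟨(x, y) :: T, ?_, by simp [h2]⟩
      rw [List.formPerm_cons_cons, ← h1]; simp [swProd]

lemma cycle_swaps (c : Perm α) (hc : c.IsCycle) :
    ∃ T : List (α × α), swProd T = c ∧ T.length + 1 = c.support.card := by
  obtain ⟨x, hx, -⟩ := id hc
  have h1 := Perm.formPerm_toList c x
  rw [hc.cycleOf_eq hx] at h1
  have h2 := Perm.length_toList c x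
  rw [hc.cycleOf_eq hx] at h2
  have : c.support.card ≠ 0 := by have := hc.two_le_card_support; omega
  obtain ⟨T, h3, h4⟩ := formPerm_swaps (c.toList x) (by intro h; rw [h] at h2; simp at h2; simp [← h2] at this)
  exact ⟨T, h3.trans h1, by rw [h4, h2]⟩

lemma swProd_append (T S : List (α × α)) : swProd (T ++ S) = swProd T * swProd S := by
  simp [swProd]

lemma perm_swaps (σ : Perm α) :
    ∃ T : List (α × α), swProd T = σ ∧ T.length + Multiset.card σ.cycleType = σ.cycleType.sum := by
  induction σ using Perm.cycle_induction_on with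
  | base_one => exact ⟨[], by simp [swProd]⟩
  | base_cycles c hc =>
    obtain ⟨T, h1, h2⟩ := cycle_swaps c hc
    exact ⟨T, h1, by simp [hc.cycleType, h2]⟩
  | induction_disjoint σ τ hd hc i1 i2 =>
    obtain ⟨T, h1, h2⟩ := i1
    obtain ⟨S, h3, h4⟩ := i2
    refine ⟨T ++ S, by rw [swProd_append, h1, h3], ?_⟩
    simp [hd.cycleType_mul]; omega

lemma list_cycles_swaps (C : List (Perm α)) (l : ℕ) (hC : ∀ c ∈ C, c.IsCycle ∧ c.support.card = l) :
    ∃ T : List (α × α), swProd T = C.prod ∧ T.length + C.length = C.length * l ∧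
      ∀ f ∈ FxL T, ∀ c ∈ C, f ∈ FxP c := by
  induction C with
  | nil => exact ⟨[], by simp [swProd]⟩
  | cons c C ih =>
    obtain ⟨T, h1, h2, h3⟩ := ih (fun c hc => hC c (by simp [hc]))
    obtain ⟨S, h4, h5⟩ := cycle_swaps c (hC c (by simp)).1
    rw [(hC c (by simp)).2] at h5
    refine ⟨S ++ T, by rw [swProd_append, h1, h4]; simp, by simp [add_mul]; omega, ?_⟩
    intro f hf d hd
    rcases List.mem_cons.1 hd with rfl | hd
    · rw [← h4]; exact FxL_le_FxP S (fun p hp => hf p (by simp [hp]))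
    · exact h3 f (fun p hp => hf p (by simp [hp])) d hd

lemma prod_apply_unique {k : ℕ} (c : Fin k → Perm α) (P : α → Prop) (i : Fin k)
    (hP : ∀ y, P y → P (c i y)) (hfix : ∀ j, j ≠ i → ∀ y, P y → c j y = y)
    (I : List (Fin k)) (hI : I.Nodup) (y : α) (hy : P y) :
    (I.map c).prod y = if i ∈ I then c i y else y := by
  induction I with
  | nil => simp
  | cons j I ih =>
    rw [List.nodup_cons] at hI
    simp only [List.map_cons, List.prod_cons, Perm.mul_apply, List.mem_cons]
    rw [ih hI.2]
    by_cases hij : i = j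
    · subst hij; simp [hI.1]
    · have := hfix j (Ne.symm hij)
      split_ifs with h1 h2 h2 <;> simp_all

lemma cycles_comp {k l m : ℕ} (c : Fin k → Perm α) (hc : ∀ i, (c i).IsCycle ∧ (c i).support.card = l)
    (σ : Perm α) (hσ : σ = (List.ofFn c).prod) (hfx : ∀ x, σ x ≠ x) (hm : 0 < m) (hml : m < l)
    (hσm : σ ^ m = 1) (W : Submodule ℚ (α → ℚ)) (hW : ∀ f ∈ W, ∀ i, f ∈ FxP (c i)) :
    2 * Module.finrank ℚ W ≤ k := by
  classical
  have hσ' : σ = ((List.finRange k).map c).prod := by rw [hσ, List.ofFn_eq_map]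
  let s : Setoid α := Setoid.ker (fun x => fun f : W => f.1 x)
  have hs : ∀ x y, s x y ↔ ∀ f ∈ W, f x = f y := by
    intro x y
    show (fun f : W => f.1 x) = (fun f : W => f.1 y) ↔ _
    simp [funext_iff]
  have hrel : ∀ i y, s (c i y) y := fun i y => (hs _ _).2 fun f hf => hW f hf i y
  have hsame : ∀ i y z, c i y ≠ y → c i z ≠ z → s y z := by
    intro i y z hy hz
    obtain ⟨j, rfl⟩ := (hc i).1.exists_pow_eq hy hz
    refine (hs _ _).2 fun f hf => ?_
    clear hz
    induction j with
    | zero => simp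
    | succ j ih => rw [ih, pow_succ', Perm.mul_apply]; exact (hW f hf i _).symm
  choose x hx _ using fun i => (hc i).1
  let φ : Fin k → Quotient s := fun i => Quotient.mk s (x i)
  have hfix : ∀ i y, φ i ≠ Quotient.mk s y → c i y = y := by
    intro i y h
    by_contra hy
    exact h (Quotient.sound (hsame i _ _ (hx i) hy))
  have hcard : ∀ q : Quotient s, 2 ≤ (Finset.univ.filter (fun i => φ i = q)).card := by
    intro q
    by_contra hlt
    have hsub : ∀ i j, φ i = q → φ j = q → i = j := by
      intro i j hi hj
      exact Finset.card_le_one.1 (by omega : (Finset.univ.filter (fun i => φ i = q)).card ≤ 1) i (by simp [hi]) j (by simp [hj])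
    by_cases hex : ∃ i, φ i = q
    · obtain ⟨i, hi⟩ := hex
      have key := prod_apply_unique c (fun y => Quotient.mk s y = q) i
        (fun y hy => (Quotient.sound (hrel i y)).trans hy)
        (fun j hj y hy => hfix j y (fun h => hj (hsub j i (h.trans hy) hi)))
        (List.finRange k) (List.nodup_finRange k)
      rw [← hσ'] at key
      simp only [List.mem_finRange, if_true] at key
      have hpow : ∀ j, (σ ^ j) (x i) = (c i ^ j) (x i) ∧ Quotient.mk s ((c i ^ j) (x i)) = q := by
        intro j
        induction j with
        | zero => exact ⟨rfl, hi⟩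
        | succ j ih =>
          rw [pow_succ', pow_succ', Perm.mul_apply, Perm.mul_apply, ih.1]
          exact ⟨key _ ih.2, (Quotient.sound (hrel i _)).trans ih.2⟩
      have h1 := (hpow m).1
      rw [hσm] at h1
      have h2 : c i ^ m = 1 := (hc i).1.pow_eq_one_iff.2 ⟨x i, hx i, h1.symm⟩
      have h3 := orderOf_dvd_of_pow_eq_one h2
      rw [(hc i).1.orderOf, (hc i).2] at h3
      exact absurd (Nat.le_of_dvd hm h3) (by omega)
    · push Not at hex
      obtain ⟨y, rfl⟩ := Quotient.exists_rep q
      apply hfx y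
      have : ∀ I : List (Fin k), (I.map c).prod y = y := by
        intro I
        induction I with
        | nil => simp
        | cons j I ih => simp [ih, hfix j y (hex j)]
      rw [hσ']; exact this _
  have h1 : 2 * Fintype.card (Quotient s) ≤ k := by
    have := Finset.card_eq_sum_card_fiberwise (f := φ) (s := Finset.univ) (t := Finset.univ) (by intro _ _; simp)
    have h2 : ∑ q : Quotient s, 2 ≤ ∑ q : Quotient s, (Finset.univ.filter (fun i => φ i = q)).card :=
      Finset.sum_le_sum fun q _ => hcard q
    rw [← this] at h2
    simp at h2
    omega
  have h2 : Module.finrank ℚ W ≤ Fintype.card (Quotient s) := by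
    have : W ≤ LinearMap.range (LinearMap.funLeft ℚ ℚ (Quotient.mk s)) := by
      intro f hf
      exact ⟨Quotient.lift f (fun a b h => (hs a b).1 h f hf), rfl⟩
    have h3 := Submodule.finrank_mono this
    have h4 := LinearMap.finrank_range_le (LinearMap.funLeft ℚ ℚ (Quotient.mk s))
    simp at h4
    omega
  omega

end Upper

lemma upper_exists (n K : ℕ) (hK0 : 0 < K) (h : 4 * K + 1 < n) : ∃ σ : Perm (Fin n), σ ∈ alternatingGroup (Fin n) ∧
    (∀ x, σ x ≠ x) ∧ (∃ m, 0 < m ∧ m < 12 ∧ σ ^ m = 1) ∧ σ.cycleType.sum = n ∧ 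
    6 * K < n + Multiset.card σ.cycleType := by
  have main : ∀ (M : Multiset ℕ) (m : ℕ), M.sum = n → (∀ a ∈ M, 2 ≤ a) → (∀ a ∈ M, a ∣ m) → 0 < m → m < 12 →
      Even (n + Multiset.card M) → 6 * K < n + Multiset.card M →
      ∃ σ : Perm (Fin n), σ ∈ alternatingGroup (Fin n) ∧
    (∀ x, σ x ≠ x) ∧ (∃ m, 0 < m ∧ m < 12 ∧ σ ^ m = 1) ∧ σ.cycleType.sum = n ∧
    6 * K < n + Multiset.card σ.cycleType := by
    intro M m hs h2 hm hm0 hm12 hev hK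
    obtain ⟨σ, hσ⟩ := (Perm.exists_with_cycleType_iff (Fin n) (m := M)).2 ⟨by simp [hs], h2⟩
    refine ⟨σ, ?_, ?_, ⟨m, hm0, hm12, ?_⟩, by rw [hσ, hs], by rw [hσ]; exact hK⟩
    · rw [Perm.mem_alternatingGroup, Perm.sign_of_cycleType, hσ, hs, hev.neg_one_pow]
    · have : σ.support = Finset.univ := by
        rw [← Finset.card_eq_iff_eq_univ, ← Perm.sum_cycleType, hσ, hs, Fintype.card_fin]
      intro x
      rw [← Perm.mem_support, this]; simp
    · apply orderOf_dvd_iff_pow_eq_one.1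
      rw [← Perm.lcm_cycleType, hσ]
      exact Multiset.lcm_dvd.2 hm
  rcases (by omega : n % 4 = 0 ∨ n % 4 = 1 ∨ n % 4 = 2 ∨ n % 4 = 3) with h0 | h0 | h0 | h0
  · refine main (Multiset.replicate (n/2) 2) 2 ?_ ?_ ?_ (by norm_num) (by norm_num) ?_ ?_
    · simp; omega
    · intro a ha; simp [Multiset.eq_of_mem_replicate ha]
    · intro a ha; simp [Multiset.eq_of_mem_replicate ha]
    · simp [Nat.even_iff]; omega
    · simp; omega
  · refine main (5 ::ₘ Multiset.replicate ((n-5)/2) 2) 10 ?_ ?_ ?_ (by norm_num) (by norm_num) ?_ ?_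
    · simp; omega
    · intro a ha; rcases Multiset.mem_cons.1 ha with rfl | ha; · norm_num
      simp [Multiset.eq_of_mem_replicate ha]
    · intro a ha; rcases Multiset.mem_cons.1 ha with rfl | ha; · norm_num
      rw [Multiset.eq_of_mem_replicate ha]; norm_num
    · simp [Nat.even_iff]; omega
    · simp; omega
  · refine main (4 ::ₘ Multiset.replicate ((n-4)/2) 2) 4 ?_ ?_ ?_ (by norm_num) (by norm_num) ?_ ?_
    · simp; omega
    · intro a ha; rcases Multiset.mem_cons.1 ha with rfl | ha; · norm_num
      simp [Multiset.eq_of_mem_replicate ha]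
    · intro a ha; rcases Multiset.mem_cons.1 ha with rfl | ha; · norm_num
      rw [Multiset.eq_of_mem_replicate ha]; norm_num
    · simp [Nat.even_iff]; omega
    · simp; omega
  · refine main (3 ::ₘ Multiset.replicate ((n-3)/2) 2) 6 ?_ ?_ ?_ (by norm_num) (by norm_num) ?_ ?_
    · simp; omega
    · intro a ha; rcases Multiset.mem_cons.1 ha with rfl | ha; · norm_num
      simp [Multiset.eq_of_mem_replicate ha]
    · intro a ha; rcases Multiset.mem_cons.1 ha with rfl | ha; · norm_num
      rw [Multiset.eq_of_mem_replicate ha]; norm_num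
    · simp [Nat.even_iff]; omega
    · simp; omega


lemma upper_part (k l K n : ℕ) (hK0 : 0 < K) (hK : k * l = 6 * K) (hl : 12 ≤ l) (hn : 4 * K + 1 < n) :
    ∃ σ ∈ alternatingGroup (Fin n), ¬ IsProdOfCycles n k l σ := by
  obtain ⟨σ, h1, h2, ⟨m, h3, h4, h5⟩, h6, h7⟩ := upper_exists n K hK0 hn
  refine ⟨σ, h1, ?_⟩
  rintro ⟨c, hc, hσ⟩
  obtain ⟨T, t1, t2, t3⟩ := list_cycles_swaps (List.ofFn c) l (by
    intro d hd; obtain ⟨i, rfl⟩ := (List.mem_ofFn' _ _).1 hd; exact hc i)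
  obtain ⟨S, s1, s2⟩ := perm_swaps σ
  have a1 := ree_ineq T
  have a2 := finrank_FxP_ge S
  have a3 := cycles_comp c hc σ hσ h2 h3 (by omega : m < l) h5 (FxL T)
    (fun f hf i => t3 f hf (c i) (by simp))
  rw [t1, ← hσ] at a1
  rw [s1] at a2
  simp at a1 a2 t2
  omega


section Lower
variable {α : Type*} [Fintype α] [DecidableEq α]

def bp (B : List (List α)) : Perm α := (B.map List.formPerm).prod

lemma fP_commute (L L' : List α) (h : L.Disjoint L') : Commute L.formPerm L'.formPerm := by
  apply Perm.Disjoint.commute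
  intro z
  by_cases hz : z ∈ L
  · right; exact List.formPerm_apply_of_notMem (fun h' => h hz h')
  · left; exact List.formPerm_apply_of_notMem hz

lemma fP_merge1 (x y : α) (U V : List α) (h : (x :: U ++ y :: V).Nodup) :
    swap x y * ((x :: U).formPerm * (y :: V).formPerm) = (x :: U ++ y :: V).formPerm := by
  induction U generalizing x with
  | nil => simp
  | cons u U ih =>
    have h' : (u :: U ++ y :: V).Nodup := (List.nodup_cons.1 h).2
    have hxu : x ≠ u := by rintro rfl; simp at h
    have hxy : x ≠ y := by rintro rfl; simp at h
    have huy : u ≠ y := by rintro rfl; simp at h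
    have e := ih u h'
    simp only [List.cons_append, List.formPerm_cons_cons] at e ⊢
    rw [← e]
    have e2 : swap x y * swap x u = swap x u * swap u y := by
      ext z
      simp only [Perm.mul_apply, swap_apply_def]
      grind
    simp only [← mul_assoc]
    rw [e2]

lemma fP_merge2 (x y : α) (U V : List α) (h : (x :: U ++ y :: V).Nodup) :
    (x :: U).formPerm * (y :: V).formPerm * swap x y = (x :: V ++ y :: U).formPerm := by
  have hx : (x :: U).Nodup := h.of_append_left
  have hy : (y :: V).Nodup := h.of_append_right
  have inv : ∀ (z : α) (W : List α), (z :: W).Nodup → (z :: W).formPerm⁻¹ = (z :: W.reverse).formPerm := by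
    intro z W hz
    rw [← List.formPerm_reverse]
    apply List.formPerm_eq_of_isRotated (List.nodup_reverse.2 hz)
    rw [List.reverse_cons]
    exact List.isRotated_append
  have p1 : (y :: V.reverse ++ x :: U.reverse).Nodup := by
    have : (y :: V.reverse ++ x :: U.reverse).Perm (x :: U ++ y :: V) :=
      List.perm_append_comm.trans (((List.reverse_perm U).cons x).append ((List.reverse_perm V).cons y))
    exact this.nodup_iff.2 h
  have e := fP_merge1 y x V.reverse U.reverse p1
  rw [← inv _ _ hx, ← inv _ _ hy] at e
  have e2 : ((x :: U).formPerm * (y :: V).formPerm * swap x y)⁻¹ = (y :: V.reverse ++ x :: U.reverse).formPerm := by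
    rw [← e]; simp [swap_comm]
  rw [← inv_inj, e2, ← List.formPerm_reverse]
  apply List.formPerm_eq_of_isRotated p1
  simp only [List.reverse_append, List.reverse_cons, List.cons_append]
  have : y :: (V.reverse ++ x :: U.reverse) = (y :: (V.reverse ++ [x])) ++ U.reverse := by simp
  rw [this]
  refine List.isRotated_append.trans ?_
  simp only [List.append_assoc, List.cons_append]
  simp [List.IsRotated.refl]

def Spl (σ : Perm α) (p q : ℕ) (S : List α) : Prop :=
  ∃ (x : α) (U V : List α), (x :: U).Nodup ∧ (x :: V).Nodup ∧ (x :: U).length = p ∧ (x :: V).length = q ∧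
    (∀ z ∈ x :: U, z ∈ S) ∧ (∀ z ∈ x :: V, z ∈ S) ∧ σ = (x :: U).formPerm * (x :: V).formPerm

lemma Spl_merge {σ ρ : Perm α} {p q p' q' : ℕ} {S S' : List α} (h : Spl σ p q S) (h' : Spl ρ p' q' S')
    (hd : S.Disjoint S') : Spl (σ * ρ) (p + p') (q + q') (S ++ S') := by
  obtain ⟨x, U, V, a1, a2, a3, a4, a5, a6, rfl⟩ := h
  obtain ⟨y, U', V', b1, b2, b3, b4, b5, b6, rfl⟩ := h'
  have n1 : (x :: U ++ y :: U').Nodup := a1.append b1 (fun z h1 h2 => hd (a5 z h1) (b5 z h2))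
  have n2 : (x :: V ++ y :: V').Nodup := a2.append b2 (fun z h1 h2 => hd (a6 z h1) (b6 z h2))
  have c : Commute (x :: V).formPerm (y :: U').formPerm :=
    fP_commute _ _ (fun z h1 h2 => hd (a6 z h1) (b5 z h2))
  have n3 : (x :: U' ++ y :: U).Nodup := by
    have : (x :: U' ++ y :: U).Perm (x :: U ++ y :: U') := by
      simp only [List.cons_append]
      refine List.Perm.cons x ?_
      refine List.perm_middle.trans (List.Perm.trans ?_ List.perm_middle.symm)
      exact List.perm_append_comm.cons y
    exact this.nodup_iff.2 n1
  refine ⟨x, U' ++ y :: U, V ++ y :: V', n3, n2, by simp at *; omega, by simp at *; omega, ?_, ?_, ?_⟩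
  · intro z hz
    simp only [List.mem_cons, List.mem_append] at hz a5 b5 ⊢
    grind
  · intro z hz
    simp only [List.mem_cons, List.mem_append] at hz a6 b6 ⊢
    grind
  · have e1 := fP_merge2 x y U U' n1
    have e2 := fP_merge1 x y V V' n2
    simp only [List.cons_append] at e1 e2
    rw [← e1, ← e2]
    calc (x :: U).formPerm * (x :: V).formPerm * ((y :: U').formPerm * (y :: V').formPerm)
        = (x :: U).formPerm * ((x :: V).formPerm * (y :: U').formPerm) * (y :: V').formPerm := by group
      _ = (x :: U).formPerm * ((y :: U').formPerm * (x :: V).formPerm) * (y :: V').formPerm := by rw [c.eq]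
      _ = (x :: U).formPerm * (y :: U').formPerm * (swap x y * swap x y) * ((x :: V).formPerm * (y :: V').formPerm) := by
          rw [swap_mul_self]; group
      _ = _ := by group

lemma fP_split (A B : List α) (x : α) :
    (A ++ x :: B).formPerm = (A ++ [x]).formPerm * (x :: B).formPerm := by
  induction A with
  | nil => simp
  | cons a A ih =>
    cases A with
    | nil => simp
    | cons a' A => simp only [List.cons_append, List.formPerm_cons_cons] at ih ⊢; rw [ih, mul_assoc]

lemma Spl_block (D : List α) (hD : D.Nodup) (p : ℕ) (h1 : 1 ≤ p) (h2 : p ≤ D.length) :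
    Spl D.formPerm p (D.length + 1 - p) D := by
  obtain ⟨A, x, B, rfl, hA⟩ : ∃ A x B, D = A ++ x :: B ∧ A.length = p - 1 := by
    refine ⟨D.take (p-1), D[p-1], D.drop p, ?_, by simp; omega⟩
    conv_lhs => rw [← List.take_append_drop (p-1) D]
    rw [List.drop_eq_getElem_cons (by omega)]
    congr 3; omega
  have hn : (x :: A).Perm (A ++ [x]) := (List.perm_append_singleton x A).symm
  have hAx : (A ++ [x]).Nodup := by
    have : (A ++ [x] ++ B).Nodup := by simpa using hD
    exact this.of_append_left
  refine ⟨x, A, B, hn.nodup_iff.2 hAx, hD.of_append_right, by simp; omega, by simp; omega, ?_, ?_, ?_⟩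
  · intro z hz; simp at hz ⊢; tauto
  · intro z hz; simp at hz ⊢; tauto
  · rw [fP_split]
    congr 1
    exact List.formPerm_eq_of_isRotated hAx List.isRotated_append

lemma Spl_blocks (B : List (List α)) (hB : B ≠ []) (hne : ∀ D ∈ B, 1 ≤ D.length) (hn : B.flatten.Nodup)
    (p : ℕ) (h1 : B.length ≤ p) (h2 : p ≤ B.flatten.length) :
    Spl (bp B) p (B.flatten.length + B.length - p) B.flatten := by
  induction B generalizing p with
  | nil => exact absurd rfl hB
  | cons D B ih =>
    have hD := hne D (by simp)
    simp only [List.flatten_cons, List.length_append, List.length_cons] at *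
    by_cases hB' : B = []
    · subst hB'
      have := Spl_block D (by simpa using hn) p (by simpa using h1) (by simpa using h2)
      simpa [bp] using this
    · have hle : B.length ≤ B.flatten.length := by
        have hne' : ∀ D ∈ B, 1 ≤ D.length := fun D hD => hne D (by simp [hD])
        clear ih hne hn h1 h2 hB hB'
        induction B with
        | nil => simp
        | cons E B ih =>
          have := ih (fun D hD => hne' D (by simp [hD]))
          have := hne' E (by simp)
          rw [List.flatten_cons, List.length_append, List.length_cons]; omega
      obtain ⟨p1, p2, rfl, q1, q2, q3, q4⟩ : ∃ p1 p2, p = p1 + p2 ∧ 1 ≤ p1 ∧ p1 ≤ D.length ∧ B.length ≤ p2 ∧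
          p2 ≤ B.flatten.length := by
        by_cases hp : p ≤ B.flatten.length + 1
        · exact ⟨1, p - 1, by omega, by omega, by omega, by omega, by omega⟩
        · exact ⟨p - B.flatten.length, B.flatten.length, by omega, by omega, by omega, by omega, by omega⟩
      have a := Spl_block D hn.of_append_left p1 q1 q2
      have b := ih hB' (fun D hD => hne D (by simp [hD])) hn.of_append_right p2 q3 q4
      have c := Spl_merge a b (List.disjoint_of_nodup_append hn)
      have e : D.length + B.flatten.length + (B.length + 1) - (p1 + p2) =
        D.length + 1 - p1 + (B.flatten.length + B.length - p2) := by omega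
      rw [e]
      simpa [bp] using c

def IsLC (l : ℕ) (a : Perm α) : Prop := a.IsCycle ∧ a.support.card = l

lemma IsLC_fP (L : List α) (hL : L.Nodup) (h2 : 2 ≤ L.length) : IsLC L.length L.formPerm := by
  refine ⟨List.isCycle_formPerm hL h2, ?_⟩
  rw [List.support_formPerm_of_nodup _ hL (by rintro x rfl; simp at h2)]
  exact List.toFinset_card_of_nodup hL

lemma IsLC_list {l : ℕ} {a : Perm α} (h : IsLC l a) (x : α) (hx : x ∈ a.support) :
    ∃ U : List α, (x :: U).Nodup ∧ a = (x :: U).formPerm ∧ (x :: U).length = l ∧ ∀ z, z ∈ x :: U → z ∈ a.support := by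
  have hx' := Perm.mem_support.1 hx
  have h1 := Perm.formPerm_toList a x
  rw [h.1.cycleOf_eq hx'] at h1
  have h2 := Perm.length_toList a x
  rw [h.1.cycleOf_eq hx', h.2] at h2
  have h3 := Perm.nodup_toList a x
  have h4 := Perm.mem_toList_iff (p := a) (x := x) (y := x)
  have h5 : x ∈ a.toList x := h4.2 ⟨Perm.SameCycle.refl _ _, hx⟩
  have h6 : ∀ z ∈ a.toList x, z ∈ a.support := by
    intro z hz
    obtain ⟨h7, -⟩ := Perm.mem_toList_iff.1 hz
    exact (Perm.SameCycle.mem_support_iff h7).1 hx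
  obtain ⟨A, B, hAB⟩ := List.append_of_mem h5
  have hr : (a.toList x).IsRotated (x :: (B ++ A)) := by
    rw [hAB]; exact List.isRotated_append
  refine ⟨B ++ A, hr.perm.nodup_iff.1 h3, ?_, by rw [← h2, hr.perm.length_eq], ?_⟩
  · rw [← List.formPerm_eq_of_isRotated h3 hr, h1]
  · intro z hz; exact h6 z (hr.perm.mem_iff.2 hz)

lemma IsLC_two_le {l : ℕ} {a : Perm α} (h : IsLC l a) : 2 ≤ l := by
  rw [← h.2]; exact h.1.two_le_card_support

lemma IsLC_swap {l : ℕ} {a : Perm α} (h : IsLC l a) (x y : α) (hx : x ∈ a.support) (hy : y ∉ a.support) :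
    IsLC (l + 1) (a * swap x y) ∧ IsLC (l + 1) (swap x y * a) := by
  obtain ⟨U, h1, h2, h3, h4⟩ := IsLC_list h x hx
  have hyU : y ∉ x :: U := fun hh => hy (h4 y hh)
  have hl := IsLC_two_le h
  have n1 : (x :: U ++ [y]).Nodup := h1.append (by simp) (by simpa using hyU)
  have n2 : (x :: y :: U).Nodup := by
    have : (x :: y :: U).Perm (x :: U ++ [y]) := (List.perm_append_singleton y U).symm.cons x
    exact this.nodup_iff.2 n1
  have e1 := fP_merge1 x y U [] n1
  have e2 := fP_merge2 x y U [] n1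
  have g1 := IsLC_fP _ n1 (by simp)
  have g2 := IsLC_fP _ n2 (by simp)
  rw [← e1] at g1
  have e3 : (x :: [] ++ y :: U) = x :: y :: U := rfl
  rw [← e3, ← e2] at g2
  rw [List.formPerm_singleton, mul_one] at g1 g2
  rw [← h2] at g1 g2
  constructor
  · convert g2 using 1; simp at h3 ⊢; omega
  · convert g1 using 1; simp at h3 ⊢; omega

def TwoC (l : ℕ) (σ : Perm α) : Prop := ∃ a b, IsLC l a ∧ IsLC l b ∧ σ = a * b

lemma TwoC_raise {l : ℕ} {σ : Perm α} (h : TwoC l σ) (hl : l < Fintype.card α) : TwoC (l + 1) σ := by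
  obtain ⟨a, b, ha, hb, rfl⟩ := h
  have key : ∀ x y, x ∈ a.support → y ∉ a.support →
      (x ∈ b.support ∧ y ∉ b.support ∨ y ∈ b.support ∧ x ∉ b.support) → TwoC (l+1) (a * b) := by
    intro x y h1 h2 h3
    refine ⟨a * swap x y, swap x y * b, (IsLC_swap ha x y h1 h2).1, ?_, ?_⟩
    · rcases h3 with h3 | h3
      · exact (IsLC_swap hb x y h3.1 h3.2).2
      · rw [swap_comm]; exact (IsLC_swap hb y x h3.1 h3.2).2
    · rw [mul_assoc, ← mul_assoc (swap x y), swap_mul_self, one_mul]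
  by_cases hs : a.support = b.support
  · have h2 := IsLC_two_le ha
    obtain ⟨x, hx⟩ : a.support.Nonempty := Finset.card_pos.1 (by rw [ha.2]; omega)
    obtain ⟨y, hy⟩ : ∃ y, y ∉ a.support := by
      by_contra hh
      push Not at hh
      have := Finset.eq_univ_iff_forall.2 hh
      have h3 := ha.2
      rw [this, Finset.card_univ] at h3
      omega
    exact key x y hx hy (Or.inl ⟨hs ▸ hx, hs ▸ hy⟩)
  · have hn1 : ¬ a.support ⊆ b.support := fun h => hs (Finset.eq_of_subset_of_card_le h (by rw [ha.2, hb.2]))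
    have hn2 : ¬ b.support ⊆ a.support := fun h => hs (Finset.eq_of_subset_of_card_le h (by rw [ha.2, hb.2])).symm
    obtain ⟨x, hx, hx'⟩ := Finset.not_subset.1 hn1
    obtain ⟨y, hy, hy'⟩ := Finset.not_subset.1 hn2
    exact key x y hx hy' (Or.inr ⟨hy, hx'⟩)

lemma TwoC_mono {l l' : ℕ} {σ : Perm α} (h : TwoC l σ) (hll : l ≤ l') (hl : l' ≤ Fintype.card α) : TwoC l' σ := by
  induction l', hll using Nat.le_induction with
  | base => exact h
  | succ m hm ih => exact TwoC_raise (ih (by omega)) (by omega)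

/-- cost of a list of blocks -/
def cost (B : List (List α)) : ℕ := (B.map (fun D => if 2 ≤ D.length then D.length + 1 else 0)).sum

lemma bp_filter (B : List (List α)) : bp (B.filter (fun D => 2 ≤ D.length)) = bp B := by
  induction B with
  | nil => rfl
  | cons D B ih =>
    by_cases h : 2 ≤ D.length
    · rw [List.filter_cons_of_pos (by simpa using h)]
      simp only [bp, List.map_cons, List.prod_cons] at ih ⊢; rw [ih]
    · rw [List.filter_cons_of_neg (by simpa using h), ih]
      have : D.formPerm = 1 := by
        rcases D with _ | ⟨x, _ | ⟨y, D⟩⟩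
        · simp
        · simp
        · simp at h
      simp [bp, this]

lemma cost_filter (B : List (List α)) : cost B =
    (B.filter (fun D => 2 ≤ D.length)).flatten.length + (B.filter (fun D => 2 ≤ D.length)).length := by
  induction B with
  | nil => rfl
  | cons D B ih =>
    have e : cost (D :: B) = (if 2 ≤ D.length then D.length + 1 else 0) + cost B := by simp [cost]
    rw [e]
    by_cases h : 2 ≤ D.length
    · rw [List.filter_cons_of_pos (by simpa using h), if_pos h]
      simp only [List.flatten_cons, List.length_append, List.length_cons]; omega
    · rw [List.filter_cons_of_neg (by simpa using h), if_neg h]; omega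

lemma sign_fP (L : List α) (hL : L.Nodup) (h : 1 ≤ L.length) : Perm.sign L.formPerm = (-1) ^ (L.length + 1) := by
  induction L with
  | nil => simp at h
  | cons x L ih =>
    cases L with
    | nil => simp
    | cons y L =>
      have hxy : x ≠ y := by rintro rfl; simp at hL
      rw [List.formPerm_cons_cons, Perm.sign_mul, ih (List.nodup_cons.1 hL).2 (by simp), Perm.sign_swap hxy]
      simp [pow_succ]

lemma sign_bp (B : List (List α)) (hne : ∀ D ∈ B, 1 ≤ D.length) (hn : B.flatten.Nodup) :
    Perm.sign (bp B) = (-1) ^ (B.flatten.length + B.length) := by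
  induction B with
  | nil => simp [bp]
  | cons D B ih =>
    have e : bp (D :: B) = D.formPerm * bp B := by simp [bp]
    rw [List.flatten_cons] at hn
    rw [e, Perm.sign_mul, sign_fP D hn.of_append_left (hne D (by simp)),
      ih (fun D hD => hne D (by simp [hD])) hn.of_append_right, ← pow_add]
    congr 1; simp; omega

lemma bp_TwoC (B : List (List α)) (hn : B.flatten.Nodup) (l : ℕ) (hl2 : 2 ≤ l) (hl : l ≤ Fintype.card α)
    (hc : cost B ≤ 2 * l) (hs : Perm.sign (bp B) = 1) : TwoC l (bp B) := by
  rw [cost_filter] at hc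
  rw [← bp_filter] at hs ⊢
  set C := B.filter (fun D => 2 ≤ D.length) with hC
  have hC2 : ∀ D ∈ C, 2 ≤ D.length := by
    intro D hD; rw [hC] at hD; simpa using (List.mem_filter.1 hD).2
  have hCn : C.flatten.Nodup := hn.sublist (List.filter_sublist.flatten)
  have hlen : 2 * C.length ≤ C.flatten.length := by
    clear_value C
    clear hc hs hCn hC
    induction C with
    | nil => simp
    | cons D C ih =>
      have := ih (fun D hD => hC2 D (by simp [hD]))
      have := hC2 D (by simp)
      rw [List.flatten_cons, List.length_append, List.length_cons]; omega
  by_cases hC0 : C = []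
  · rw [hC0]
    obtain ⟨x, y, hxy⟩ := Fintype.exists_pair_of_one_lt_card (by omega : 1 < Fintype.card α)
    have : IsLC 2 (swap x y) := ⟨Perm.isCycle_swap hxy, Perm.card_support_swap hxy⟩
    exact TwoC_mono ⟨_, _, this, this, by simp [bp]⟩ hl2 hl
  have hpos : 0 < C.length := List.length_pos_iff.2 hC0
  rw [sign_bp C (fun D hD => by have := hC2 D hD; omega) hCn] at hs
  have hev : Even (C.flatten.length + C.length) := by
    by_contra h
    rw [Nat.not_even_iff_odd] at h
    rw [h.neg_one_pow] at hs
    exact absurd hs (by decide)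
  obtain ⟨p, hp⟩ := hev
  have := Spl_blocks C hC0 (fun D hD => by have := hC2 D hD; omega) hCn p (by omega) (by omega)
  obtain ⟨x, U, V, a1, a2, a3, a4, -, -, a5⟩ := this
  have g1 := IsLC_fP _ a1 (by omega)
  have g2 := IsLC_fP _ a2 (by omega)
  rw [a3] at g1
  rw [a4, show C.flatten.length + C.length - p = p by omega] at g2
  exact TwoC_mono ⟨_, _, g1, g2, a5⟩ (by omega) hl

end Lower

section Lower2
variable {α : Type*} [Fintype α] [DecidableEq α]

lemma bp_append (B C : List (List α)) : bp (B ++ C) = bp B * bp C := by simp [bp]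
lemma bp_cons (D : List α) (C : List (List α)) : bp (D :: C) = D.formPerm * bp C := by simp [bp]
lemma cost_append (B C : List (List α)) : cost (B ++ C) = cost B + cost C := by simp [cost]
lemma cost_cons (D : List α) (C : List (List α)) :
    cost (D :: C) = (if 2 ≤ D.length then D.length + 1 else 0) + cost C := by simp [cost]

lemma bp_notMem (B : List (List α)) (z : α) (hz : z ∉ B.flatten) : bp B z = z := by
  induction B with
  | nil => simp [bp]
  | cons D B ih =>
    rw [List.flatten_cons, List.mem_append, not_or] at hz
    rw [bp_cons, Perm.mul_apply, ih hz.2, List.formPerm_apply_of_notMem hz.1]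

lemma decomp (σ : Perm α) : ∃ B : List (List α), bp B = σ ∧ B.flatten.Nodup ∧ (∀ D ∈ B, 2 ≤ D.length) ∧
    ∀ z ∈ B.flatten, z ∈ σ.support := by
  induction σ using Perm.cycle_induction_on with
  | base_one => exact ⟨[], by simp [bp]⟩
  | base_cycles c hc =>
    obtain ⟨x, hx, -⟩ := id hc
    obtain ⟨U, h1, h2, h3, h4⟩ := IsLC_list (⟨hc, rfl⟩ : IsLC c.support.card c) x (Perm.mem_support.2 hx)
    refine ⟨[x :: U], by simp [bp, ← h2], by simpa using h1, ?_, by simpa using h4⟩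
    intro D hD
    rw [List.mem_singleton.1 hD, h3]
    exact hc.two_le_card_support
  | induction_disjoint σ τ hd hc i1 i2 =>
    obtain ⟨B, a1, a2, a3, a4⟩ := i1
    obtain ⟨C, b1, b2, b3, b4⟩ := i2
    have hds := hd.disjoint_support
    refine ⟨B ++ C, by rw [bp_append, a1, b1], ?_, ?_, ?_⟩
    · rw [List.flatten_append]
      exact a2.append b2 (fun z h1 h2 => Finset.disjoint_left.1 hds (a4 z h1) (b4 z h2))
    · intro D hD
      rcases List.mem_append.1 hD with h | h
      · exact a3 D h
      · exact b3 D h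
    · intro z hz
      rw [hd.support_mul, Finset.mem_union]
      rw [List.flatten_append, List.mem_append] at hz
      exact hz.imp (a4 z) (b4 z)

lemma bp_perm (B C : List (List α)) (h : B.Perm C) (hn : B.flatten.Nodup) : bp B = bp C := by
  refine (h.map List.formPerm).prod_eq' ?_
  rw [List.pairwise_map]
  exact (List.nodup_flatten.1 hn).2.imp (fun h => fP_commute _ _ h)

lemma flatten_split (B : List (List α)) (M : ℕ) (h : M < B.flatten.length) :
    ∃ Q D R, B = Q ++ D :: R ∧ Q.flatten.length ≤ M ∧ M < Q.flatten.length + D.length := by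
  induction B generalizing M with
  | nil => simp at h
  | cons E B ih =>
    by_cases hE : M < E.length
    · exact ⟨[], E, B, by simp, by simp, by simpa using hE⟩
    · rw [List.flatten_cons, List.length_append] at h
      obtain ⟨Q, D, R, h1, h2, h3⟩ := ih (M - E.length) (by omega)
      refine ⟨E :: Q, D, R, by simp [h1], ?_, ?_⟩ <;>
      · rw [List.flatten_cons, List.length_append]; omega

lemma append_split {β : Type*} (W X Y R : List β) (d : β) (h : W ++ X = Y ++ d :: R) :
    (∃ A, Y = W ++ A ∧ X = A ++ d :: R) ∨ ∃ B, W = Y ++ d :: B ∧ R = B ++ X := by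
  rcases List.append_eq_append_iff.1 h with ⟨A, h1, h2⟩ | ⟨A, h1, h2⟩
  · exact Or.inl ⟨A, h1, h2⟩
  · cases A with
    | nil => left; exact ⟨[], by simpa using h1.symm, by simpa using h2.symm⟩
    | cons a A =>
      right
      simp only [List.cons_append, List.cons.injEq] at h2
      exact ⟨A, by rw [h1, h2.1], h2.2⟩

lemma num1 (F : List (List α)) (h : ∀ D ∈ F, D.length = 1) : F.flatten.length = F.length ∧ cost F = 0 := by
  induction F with
  | nil => simp [cost]
  | cons D F ih =>
    have h1 := ih (fun D hD => h D (by simp [hD]))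
    have h2 := h D (by simp)
    rw [List.flatten_cons, List.length_append, List.length_cons, cost_cons, if_neg (by omega)]
    omega

lemma num3 (F : List (List α)) (h : ∀ D ∈ F, 3 ≤ D.length) :
    3 * F.length ≤ F.flatten.length ∧ cost F = F.flatten.length + F.length := by
  induction F with
  | nil => simp [cost]
  | cons D F ih =>
    have h1 := ih (fun D hD => h D (by simp [hD]))
    have h2 := h D (by simp)
    rw [List.flatten_cons, List.length_append, List.length_cons, cost_cons, if_pos (by omega)]
    omega

lemma num2 (F : List (List α)) (h : ∀ D ∈ F, D.length = 2) :
    F.flatten.length = 2 * F.length ∧ cost F = 3 * F.length := by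
  induction F with
  | nil => simp [cost]
  | cons D F ih =>
    have h1 := ih (fun D hD => h D (by simp [hD]))
    have h2 := h D (by simp)
    rw [List.flatten_cons, List.length_append, List.length_cons, cost_cons, if_pos (by omega)]
    omega

lemma fP_agree (P X Y : List α) (d z : α) (h1 : (P ++ d :: X).Nodup) (h2 : (P ++ d :: Y).Nodup) (hz : z ∈ P) :
    (P ++ d :: X).formPerm z = (P ++ d :: Y).formPerm z := by
  have n1 : z ∉ d :: X := fun h => List.disjoint_of_nodup_append h1 hz h
  have n2 : z ∉ d :: Y := fun h => List.disjoint_of_nodup_append h2 hz h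
  rw [fP_split P X, fP_split P Y, Perm.mul_apply, Perm.mul_apply, List.formPerm_apply_of_notMem n1,
    List.formPerm_apply_of_notMem n2]

lemma even_of_sign (n : ℕ) (h : ((-1 : ℤˣ)) ^ n = 1) : n % 2 = 0 := by
  rw [← Nat.even_iff]
  by_contra h'
  rw [Nat.not_even_iff_odd] at h'
  rw [h'.neg_one_pow] at h
  exact absurd h (by decide)

/-- numeric heart of the selection -/
lemma select_num (F L3 L2 Q R : List (List α)) (D : List α) (M t : ℕ)
    (hF : ∀ D ∈ F, D.length = 1) (h3 : ∀ D ∈ L3, 3 ≤ D.length) (h2 : ∀ D ∈ L2, D.length = 2)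
    (hB : F ++ (L3 ++ L2) = Q ++ D :: R) (hM : 4 ≤ M) (htot : (F ++ (L3 ++ L2)).flatten.length = 4 * t)
    (hev : (4 * t + (F ++ (L3 ++ L2)).length) % 2 = 0)
    (hq1 : Q.flatten.length ≤ 4 * M) (hq2 : 4 * M < Q.flatten.length + D.length) :
    ((4 * M + Q.length) % 2 = 0 →
      cost Q + (if 2 ≤ (4 * M - Q.flatten.length) + 1 then (4 * M - Q.flatten.length) + 1 + 1 else 0) ≤ 6 * M) ∧
    ((4 * M + Q.length) % 2 = 1 → cost Q + ((4 * M - Q.flatten.length) + 3) ≤ 6 * M) := by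
  have f := num1 F hF
  have c3 := num3 L3 h3
  have c2 := num2 L2 h2
  simp only [List.flatten_append, List.length_append] at htot hev
  rcases append_split _ _ _ _ _ hB with ⟨A, rfl, hA⟩ | ⟨A, rfl, hA⟩
  · rcases append_split _ _ _ _ _ hA with ⟨A', rfl, rfl⟩ | ⟨A', rfl, hA'⟩
    · have a2 := num2 A' (fun D hD => h2 D (by simp [hD]))
      have d2 := h2 D (by simp)
      have r2 := num2 R (fun D hD => h2 D (by simp [hD]))
      simp only [List.flatten_append, List.length_append, List.length_cons, List.flatten_cons, cost_append] at *
      have hr : 4 * M - (F.flatten.length + (L3.flatten.length + A'.flatten.length)) = 0 := by omega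
      rw [hr]
      simp only [Nat.reduceLeDiff, zero_add, if_false]
      constructor <;> intro hp <;> omega
    · have a3 := num3 A (fun D hD => h3 D (by simp [hD]))
      have d3 := h3 D (by simp)
      simp only [List.flatten_append, List.length_append, List.length_cons, List.flatten_cons, cost_append] at *
      constructor
      · intro hp
        split_ifs <;> omega
      · intro hp; omega
  · have a1 := num1 Q (fun D hD => hF D (by simp [hD]))
    have d1 := hF D (by simp)
    constructor
    · intro hp
      rw [if_neg (by omega)]; omega
    · intro hp; omega

lemma select (F L3 L2 : List (List α)) (M t : ℕ)
    (hF : ∀ D ∈ F, D.length = 1) (h3 : ∀ D ∈ L3, 3 ≤ D.length) (h2 : ∀ D ∈ L2, D.length = 2)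
    (hM : 4 ≤ M) (hn : (F ++ (L3 ++ L2)).flatten.Nodup)
    (htot : (F ++ (L3 ++ L2)).flatten.length = 4 * t) (hMt : M < t) (hcard : 3 * M ≤ Fintype.card α)
    (hs : Perm.sign (bp (F ++ (L3 ++ L2))) = 1) :
    ∃ τ : Perm α, TwoC (3 * M) τ ∧ Perm.sign τ = 1 ∧ ∃ A : List α, A.Nodup ∧ A.length = 4 * M ∧
      (∀ z ∈ A, z ∈ (F ++ (L3 ++ L2)).flatten) ∧
      (∀ z, z ∈ A ∨ z ∉ (F ++ (L3 ++ L2)).flatten → (τ⁻¹ * bp (F ++ (L3 ++ L2))) z = z) := by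
  have hne : ∀ D ∈ F ++ (L3 ++ L2), 1 ≤ D.length := by
    intro D hD
    simp only [List.mem_append] at hD
    rcases hD with h | h | h
    · rw [hF D h]
    · have := h3 D h; omega
    · rw [h2 D h]; omega
  obtain ⟨Q, D, R, hB, hq1, hq2⟩ := flatten_split (F ++ (L3 ++ L2)) (4 * M) (by omega)
  have hev := hs
  rw [sign_bp _ hne hn, htot] at hev
  have hnum := select_num F L3 L2 Q R D M t hF h3 h2 hB hM htot (even_of_sign _ hev) hq1 hq2
  rw [hB] at hn htot hne hs ⊢
  clear hev hB hF h3 h2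
  obtain ⟨P, d, D', rfl, hP⟩ : ∃ P d D', D = P ++ d :: D' ∧ P.length = 4 * M - Q.flatten.length := by
    refine ⟨D.take (4 * M - Q.flatten.length), D[4 * M - Q.flatten.length],
      D.drop (4 * M - Q.flatten.length + 1), ?_, by rw [List.length_take]; omega⟩
    conv_lhs => rw [← List.take_append_drop (4 * M - Q.flatten.length) D]
    rw [List.drop_eq_getElem_cons (by omega)]
  rw [← hP] at hnum
  obtain ⟨w, W, hW⟩ : ∃ w W, D' ++ R.flatten = w :: W := by
    cases h : D' ++ R.flatten with
    | cons w W => exact ⟨w, W, rfl⟩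
    | nil =>
      exfalso
      have hl : (D' ++ R.flatten).length = 0 := by rw [h]; rfl
      simp only [List.flatten_append, List.length_append, List.length_cons, List.flatten_cons] at htot hl
      omega
  have hfl : (Q ++ (P ++ d :: D') :: R).flatten = Q.flatten ++ (P ++ d :: w :: W) := by
    rw [List.flatten_append, List.flatten_cons, ← hW]; simp
  rw [hfl] at hn ⊢
  -- general construction
  have key : ∀ X Y : List α, X ++ Y = w :: W → (4 * M + Q.length + X.length) % 2 = 0 →
      cost (Q ++ [P ++ d :: X]) ≤ 6 * M →
      ∃ τ : Perm α, TwoC (3 * M) τ ∧ Perm.sign τ = 1 ∧ ∃ A : List α, A.Nodup ∧ A.length = 4 * M ∧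
      (∀ z ∈ A, z ∈ Q.flatten ++ (P ++ d :: w :: W)) ∧
      (∀ z, z ∈ A ∨ z ∉ Q.flatten ++ (P ++ d :: w :: W) →
        (τ⁻¹ * bp (Q ++ (P ++ d :: D') :: R)) z = z) := by
    intro X Y hXY hpar hcost
    have hn' : (Q ++ [P ++ d :: X]).flatten.Nodup := by
      rw [← hXY] at hn
      have e : Q.flatten ++ (P ++ d :: (X ++ Y)) = (Q ++ [P ++ d :: X]).flatten ++ Y := by simp
      rw [e] at hn
      exact hn.of_append_left
    have hsg : Perm.sign (bp (Q ++ [P ++ d :: X])) = 1 := by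
      rw [sign_bp _ _ hn']
      · apply Even.neg_one_pow
        rw [Nat.even_iff]
        simp only [List.flatten_append, List.length_append, List.length_cons, List.flatten_cons,
          List.flatten_nil, List.length_nil]
        omega
      · intro E hE
        rcases List.mem_append.1 hE with h | h
        · exact hne E (by simp [h])
        · rw [List.mem_singleton.1 h]; simp; omega
    refine ⟨bp (Q ++ [P ++ d :: X]), bp_TwoC _ hn' _ (by omega) hcard (by omega) hsg, hsg,
      Q.flatten ++ P, ?_, ?_, ?_, ?_⟩
    · rw [← List.append_assoc] at hn; exact hn.of_append_left
    · rw [List.length_append]; omega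
    · intro z hz; simp only [List.mem_append] at hz ⊢; tauto
    · intro z hz
      have e : (bp (Q ++ [P ++ d :: X]))⁻¹ * bp (Q ++ (P ++ d :: D') :: R) =
          ((P ++ d :: X).formPerm)⁻¹ * ((P ++ d :: D').formPerm * bp R) := by
        rw [bp_append, bp_append, bp_cons, bp_cons]
        simp [bp]
      rw [e, Perm.mul_apply, Perm.inv_eq_iff_eq, Perm.mul_apply]
      have hXm : ∀ y ∈ X, y ∈ w :: W := fun y hy => by rw [← hXY]; simp [hy]
      have hDm : ∀ y ∈ D', y ∈ w :: W := fun y hy => by rw [← hW]; simp [hy]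
      have hRm : ∀ y ∈ R.flatten, y ∈ w :: W := fun y hy => by
        rw [← hW]; exact List.mem_append_right _ hy
      have hout : ∀ z, z ∉ P ++ d :: w :: W →
          (P ++ d :: D').formPerm (bp R z) = (P ++ d :: X).formPerm z := by
        intro z hz
        have hz' : z ∉ P ∧ z ≠ d ∧ z ∉ w :: W := by
          simp only [List.mem_append, List.mem_cons] at hz ⊢; tauto
        rw [bp_notMem R z (fun h => hz'.2.2 (hRm z h)), List.formPerm_apply_of_notMem,
          List.formPerm_apply_of_notMem]
        · rw [List.mem_append, List.mem_cons]
          rintro (h | h | h)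
          · exact hz'.1 h
          · exact hz'.2.1 h
          · exact hz'.2.2 (hXm z h)
        · rw [List.mem_append, List.mem_cons]
          rintro (h | h | h)
          · exact hz'.1 h
          · exact hz'.2.1 h
          · exact hz'.2.2 (hDm z h)
      rcases hz with hz | hz
      · rcases List.mem_append.1 hz with hz | hz
        · exact hout z (fun h => List.disjoint_of_nodup_append hn hz h)
        · have hn2 := hn.of_append_right
          have hzw : z ∉ d :: w :: W := fun h => List.disjoint_of_nodup_append hn2 hz h
          rw [bp_notMem R z (fun h => hzw (List.mem_cons_of_mem _ (hRm z h)))]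
          apply fP_agree
          · have e2 : P ++ d :: w :: W = (P ++ d :: D') ++ R.flatten := by rw [← hW]; simp
            rw [e2] at hn2; exact hn2.of_append_left
          · have e2 : P ++ d :: w :: W = (P ++ d :: X) ++ Y := by rw [← hXY]; simp
            rw [e2] at hn2; exact hn2.of_append_left
          · exact hz
      · exact hout z (fun h => hz (List.mem_append_right _ h))
  rcases Nat.mod_two_eq_zero_or_one (4 * M + Q.length) with hpar | hpar
  · refine key [] (w :: W) rfl (by simpa using hpar) ?_
    have := hnum.1 hpar
    rw [cost_append, cost_cons]
    simpa [cost] using this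
  · refine key [w] W rfl (by simp; omega) ?_
    have := hnum.2 hpar
    rw [cost_append, cost_cons, if_pos (by simp)]
    simp [cost] at this ⊢
    omega

/-- product of `k` cycles of length `l`, as list -/
def LProd (k l : ℕ) (σ : Perm α) : Prop :=
  ∃ C : List (Perm α), C.length = k ∧ (∀ c ∈ C, c.IsCycle ∧ c.support.card = l) ∧ σ = C.prod

lemma lower_main (M : ℕ) (hM : 4 ≤ M) (j : ℕ) (hcard : (j + 1) * (4 * M) ≤ Fintype.card α)
    (σ : Perm α) (hs : Perm.sign σ = 1) (hsup : σ.support.card ≤ (j + 1) * (4 * M)) :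
    LProd (2 * (j + 1)) (3 * M) σ := by
  induction j generalizing σ with
  | zero =>
    obtain ⟨B, b1, b2, b3, b4⟩ := decomp σ
    have hlen : B.flatten.length ≤ σ.support.card := by
      rw [← List.toFinset_card_of_nodup b2]
      exact Finset.card_le_card (fun z hz => b4 z (List.mem_toFinset.1 hz))
    have hc : 2 * cost B ≤ 3 * B.flatten.length := by
      clear b1 b2 b4 hlen
      induction B with
      | nil => simp [cost]
      | cons D B ih =>
        have := ih (fun D hD => b3 D (by simp [hD]))
        have := b3 D (by simp)
        rw [List.flatten_cons, List.length_append, cost_cons, if_pos this]; omega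
    obtain ⟨a, b, ha, hb, hab⟩ := bp_TwoC B b2 (3 * M) (by omega) (by omega) (by omega) (by rw [b1]; exact hs)
    refine ⟨[a, b], rfl, ?_, by rw [← b1, hab]; simp⟩
    intro c hc
    simp only [List.mem_cons, List.not_mem_nil, or_false] at hc
    rcases hc with rfl | rfl
    · exact ha
    · exact hb
  | succ j ih =>
    obtain ⟨B, b1, b2, b3, b4⟩ := decomp σ
    obtain ⟨S, hS1, hS2⟩ := Finset.exists_superset_card_eq hsup hcard
    have hBS : B.flatten.toFinset ⊆ S := fun z hz => hS1 (b4 z (List.mem_toFinset.1 hz))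
    set F : List (List α) := (S \ B.flatten.toFinset).toList.map (fun x => [x]) with hFdef
    have hFf : F.flatten = (S \ B.flatten.toFinset).toList := by
      rw [hFdef]
      generalize (S \ B.flatten.toFinset).toList = T
      induction T with
      | nil => rfl
      | cons x T ih => simp [ih]
    have hF1 : ∀ D ∈ F, D.length = 1 := by
      intro D hD
      rw [hFdef] at hD
      obtain ⟨x, -, rfl⟩ := List.mem_map.1 hD
      rfl
    set L3 := B.filter (fun D => 3 ≤ D.length) with hL3
    set L2 := B.filter (fun D => !decide (3 ≤ D.length)) with hL2
    have hperm : (L3 ++ L2).Perm B := List.filter_append_perm _ B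
    have h3 : ∀ D ∈ L3, 3 ≤ D.length := by
      intro D hD; rw [hL3] at hD; simpa using (List.mem_filter.1 hD).2
    have h2 : ∀ D ∈ L2, D.length = 2 := by
      intro D hD; rw [hL2] at hD
      have e1 := (List.mem_filter.1 hD).2
      have e2 := b3 D (List.mem_filter.1 hD).1
      simp at e1; omega
    have hfp : (L3 ++ L2).flatten.Perm B.flatten := hperm.flatten
    have hfm : ∀ z, z ∈ (F ++ (L3 ++ L2)).flatten ↔ z ∈ S := by
      intro z
      rw [List.flatten_append, List.mem_append, hFf, hfp.mem_iff]
      simp only [Finset.mem_toList, Finset.mem_sdiff, List.mem_toFinset]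
      have := @hBS z
      rw [List.mem_toFinset] at this
      tauto
    have hnd : (F ++ (L3 ++ L2)).flatten.Nodup := by
      rw [List.flatten_append, hFf]
      refine (Finset.nodup_toList _).append (hfp.nodup_iff.2 b2) ?_
      intro z h1 h2
      rw [Finset.mem_toList, Finset.mem_sdiff, List.mem_toFinset] at h1
      exact h1.2 (hfp.mem_iff.1 h2)
    have hlen : (F ++ (L3 ++ L2)).flatten.length = 4 * ((j + 1 + 1) * M) := by
      rw [← List.toFinset_card_of_nodup hnd]
      have : (F ++ (L3 ++ L2)).flatten.toFinset = S := by
        ext z; rw [List.mem_toFinset, hfm]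
      rw [this, hS2]; ring
    have hbp : bp (F ++ (L3 ++ L2)) = σ := by
      have hbF : bp F = 1 := by
        clear_value F
        clear hFf hfm hnd hlen hFdef
        induction F with
        | nil => simp [bp]
        | cons D F ih =>
          obtain ⟨x, rfl⟩ := List.length_eq_one_iff.1 (hF1 D (by simp))
          rw [bp_cons, ih (fun D hD => hF1 D (by simp [hD]))]; simp
      rw [bp_append, hbF, one_mul, ← b1]
      exact (bp_perm _ _ hperm.symm b2).symm
    have hcard' : (j + 1) * (4 * M) + 4 * M ≤ Fintype.card α := by
      have : (j + 1 + 1) * (4 * M) = (j + 1) * (4 * M) + 4 * M := by ring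
      omega
    have hsel := select F L3 L2 M ((j + 1 + 1) * M) hF1 h3 h2 hM hnd hlen (by nlinarith)
      (by omega) (by rw [hbp]; exact hs)
    rw [hbp] at hsel
    obtain ⟨τ, ⟨a, b, ha, hb, hab⟩, hτs, A, hA1, hA2, hA3, hA4⟩ := hsel
    have hsup' : (τ⁻¹ * σ).support ⊆ S \ A.toFinset := by
      intro z hz
      rw [Perm.mem_support] at hz
      rw [Finset.mem_sdiff, List.mem_toFinset]
      constructor
      · by_contra h
        exact hz (hA4 z (Or.inr (fun h' => h ((hfm z).1 h'))))
      · intro h; exact hz (hA4 z (Or.inl h))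
    have hc := Finset.card_le_card hsup'
    rw [Finset.card_sdiff_of_subset (fun z hz => (hfm z).1 (hA3 z (List.mem_toFinset.1 hz))),
      List.toFinset_card_of_nodup hA1, hA2, hS2] at hc
    obtain ⟨C, c1, c2, c3⟩ := ih (by omega) (τ⁻¹ * σ) (by simp [hτs, hs]) (by
      have : (j + 1 + 1) * (4 * M) = (j + 1) * (4 * M) + 4 * M := by ring
      omega)
    refine ⟨a :: b :: C, by simp; omega, ?_, ?_⟩
    · intro c hc
      rcases List.mem_cons.1 hc with rfl | hc
      · exact ha
      rcases List.mem_cons.1 hc with rfl | hc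
      · exact hb
      exact c2 c hc
    · rw [List.prod_cons, List.prod_cons, ← mul_assoc, ← hab, ← c3, mul_inv_cancel_left]

end Lower2

theorem n_k_l_bounds_l_even (k l : ℕ) (hk : 2 ≤ k) (hke : Even k)
    (hl : 12 ≤ l) (hl3 : 3 ∣ l) (hle : Even l) :
    (∀ σ ∈ alternatingGroup (Fin (2 * k * l / 3)),
      IsProdOfCycles (2 * k * l / 3) k l σ) ∧
    (∀ n : ℕ, 2 * k * l / 3 + 1 < n →
      ∃ σ ∈ alternatingGroup (Fin n), ¬ IsProdOfCycles n k l σ) := by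
  obtain ⟨M, rfl⟩ := hl3
  obtain ⟨i, hi⟩ := hke
  obtain ⟨j, rfl⟩ : ∃ j, i = j + 1 := ⟨i - 1, by omega⟩
  have hk' : k = 2 * (j + 1) := by omega
  subst hk'
  have hN : 2 * (2 * (j + 1)) * (3 * M) / 3 = (j + 1) * (4 * M) := by
    rw [show 2 * (2 * (j + 1)) * (3 * M) = 3 * ((j + 1) * (4 * M)) by ring]
    exact Nat.mul_div_cancel_left _ (by norm_num)
  rw [hN]
  constructor
  · intro σ hσ
    obtain ⟨C, c1, c2, c3⟩ := lower_main M (by omega) j (by simp) σ (Perm.mem_alternatingGroup.1 hσ)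
      (by simpa using Finset.card_le_univ σ.support)
    refine ⟨fun i => C.get (i.cast c1.symm), fun i => c2 _ (List.get_mem _ _), ?_⟩
    rw [c3]
    congr 1
    have aux : ∀ (k : ℕ) (h : C.length = k), C = List.ofFn fun i : Fin k => C.get (i.cast h.symm) := by
      rintro _ rfl
      exact (List.ofFn_get C).symm
    exact aux _ c1
  · intro n hn
    refine upper_part _ _ ((j + 1) * M) n (Nat.mul_pos (by omega) (by omega)) (by ring) hl (by linarith)
end

section
/- Let k ≥ 2 be even and let n be a natural number with 6 ≤ n ≤ 4k + 1. Let σ ∈ A_n be such that n_σ ≤ k + 1. Then σ can be written as a product of k many 6-cycles of S_n. -/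
open Equiv

section aux

set_option linter.unusedSectionVars false
set_option linter.unusedSimpArgs false

variable {α : Type*} [Fintype α] [DecidableEq α]

/-- product of `k` six-cycles, list version -/
def SixProd (k : ℕ) (σ : Perm α) : Prop :=
  ∃ L : List (Perm α), L.length = k ∧ (∀ c ∈ L, c.cycleType = {6}) ∧ σ = L.prod

theorem SixProd.conj {k : ℕ} {σ τ : Perm α} (h : SixProd k σ) (hc : IsConj σ τ) :
    SixProd k τ := by
  obtain ⟨g, rfl⟩ := isConj_iff.1 hc
  obtain ⟨L, h1, h2, rfl⟩ := h
  refine ⟨L.map (MulAut.conj g), by simpa using h1, ?_, ?_⟩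
  · intro c hc
    obtain ⟨d, hd, rfl⟩ := List.mem_map.1 hc
    rw [MulAut.conj_apply, Perm.cycleType_conj]
    exact h2 d hd
  · rw [← map_list_prod, MulAut.conj_apply]

theorem SixProd.cons {k : ℕ} {γ τ : Perm α} (hγ : γ.cycleType = {6}) (h : SixProd k τ) :
    SixProd (k + 1) (γ * τ) := by
  obtain ⟨L, h1, h2, rfl⟩ := h
  refine ⟨γ :: L, by simp [h1], ?_, by simp⟩
  intro c hc
  rcases List.mem_cons.1 hc with rfl | hc
  · exact hγ
  · exact h2 c hc

theorem ct_formPerm {l : List α} (h : l.Nodup) (h2 : 2 ≤ l.length) :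
    l.formPerm.cycleType = {l.length} := by
  rw [(List.isCycle_formPerm h h2).cycleType, List.support_formPerm_of_nodup _ h,
    List.toFinset_card_of_nodup h]
  rintro x rfl
  simp at h2

theorem disj_formPerm {l m : List α} (h : ∀ x ∈ l, x ∉ m) :
    Perm.Disjoint l.formPerm m.formPerm := by
  intro x
  by_cases hx : x ∈ l
  · right; exact List.formPerm_apply_of_notMem (h x hx)
  · left; exact List.formPerm_apply_of_notMem hx

theorem ct_prod (Ls : List (List α)) (h : Ls.flatten.Nodup) (h2 : ∀ l ∈ Ls, 2 ≤ l.length) :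
    (Ls.map List.formPerm).prod.cycleType = (Ls.map List.length : List ℕ) := by
  induction Ls with
  | nil => simp
  | cons l Ls ih =>
    rw [List.flatten_cons, List.nodup_append] at h
    obtain ⟨hl, hLs, hd⟩ := h
    rw [List.map_cons, List.prod_cons, Perm.Disjoint.cycleType_mul,
      ih hLs (fun m hm => h2 m (by simp [hm])), ct_formPerm hl (h2 l (by simp))]
    · rfl
    · apply Perm.disjoint_prod_right
      intro g hg
      obtain ⟨m, hm, rfl⟩ := List.mem_map.1 hg
      apply disj_formPerm
      intro x hx hxm
      exact hd x hx x (List.mem_flatten.2 ⟨m, hm, hxm⟩) rfl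

theorem realize (t : List ℕ) (S : List α) (hS : S.Nodup) (ht : t.sum ≤ S.length) :
    ∃ Ls : List (List α), Ls.map List.length = t ∧ Ls.flatten.Sublist S := by
  induction t generalizing S with
  | nil => exact ⟨[], by simp⟩
  | cons a t ih =>
    rw [List.sum_cons] at ht
    obtain ⟨Ls, h1, h2⟩ := ih (S.drop a) (hS.sublist (List.drop_sublist _ _))
      (by rw [List.length_drop]; omega)
    refine ⟨S.take a :: Ls, ?_, ?_⟩
    · simp [h1]; omega
    · rw [List.flatten_cons]
      conv_rhs => rw [← List.take_append_drop a S]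
      exact List.Sublist.append (List.Sublist.refl _) h2

theorem reduce {k : ℕ} (σ : Perm α) (t : List ℕ) (ht : σ.cycleType = t)
    (H : ∀ Ls : List (List α), Ls.map List.length = t → Ls.flatten.Nodup →
      SixProd k (Ls.map List.formPerm).prod) : SixProd k σ := by
  have hs := σ.sum_cycleType_le
  rw [ht, Multiset.sum_coe] at hs
  obtain ⟨Ls, h1, h2⟩ := realize t (Finset.univ : Finset α).toList (Finset.nodup_toList _)
    (by simpa using hs)
  have hn := (Finset.nodup_toList _).sublist h2
  refine (H Ls h1 hn).conj ?_
  rw [Perm.isConj_iff_cycleType_eq, ct_prod Ls hn, h1, ht]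
  intro l hl
  apply Perm.two_le_of_mem_cycleType (σ := σ)
  rw [ht, ← h1]
  simpa using ⟨l, hl, rfl⟩

theorem fp_append (l m : List α) (x : α) :
    (l ++ x :: m).formPerm = (l ++ [x]).formPerm * (x :: m).formPerm := by
  induction l with
  | nil => simp
  | cons a l ih =>
    cases l with
    | nil => simp
    | cons b l =>
      simp only [List.cons_append, List.formPerm_cons_cons] at ih ⊢
      rw [ih, mul_assoc]

theorem fp_rot (l m : List α) (h : (l ++ m).Nodup) : (l ++ m).formPerm = (m ++ l).formPerm :=
  List.formPerm_eq_of_isRotated h List.isRotated_append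

/-- merging two cycles -/
theorem fp_merge (L M : List α) (x y : α) (h : (x :: L ++ y :: M).Nodup) :
    (L ++ [y]).formPerm * (M ++ [x]).formPerm = (x :: L ++ y :: M).formPerm * swap x y := by
  have h1 : (x :: L ++ y :: M).formPerm = (L ++ y :: (M ++ [x])).formPerm := by
    have := fp_rot [x] (L ++ y :: M) (by simpa using h)
    simpa using this
  have h2 : (y :: (M ++ [x])).formPerm = (M ++ [x, y]).formPerm := by
    have := fp_rot [y] (M ++ [x]) (by
      simp only [List.cons_append, List.nodup_cons, List.nodup_append, List.mem_append,
        List.mem_cons] at h ⊢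
      grind)
    simpa using this
  have h3 : (M ++ [x, y]).formPerm = (M ++ [x]).formPerm * swap x y := by
    rw [fp_append]; simp
  rw [h1, fp_append L (M ++ [x]) y, h2, h3, mul_assoc, mul_assoc, swap_mul_self, mul_one]

theorem two_cycles (L L' M M' : List α) (x y : α)
    (h : ((L ++ y :: L') ++ (M ++ x :: M')).Nodup) :
    (L ++ y :: L').formPerm * (M ++ x :: M').formPerm =
      (x :: L ++ y :: M).formPerm * (y :: L' ++ x :: M').formPerm := by
  have hn1 : (x :: L ++ y :: M).Nodup := by
    simp only [List.cons_append, List.nodup_cons, List.nodup_append, List.mem_append,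
        List.mem_cons] at h ⊢
    grind
  have hn2 : ([x] ++ (y :: L')).Nodup := by
    simp only [List.cons_append, List.nodup_cons, List.nodup_append, List.mem_append,
        List.mem_cons] at h ⊢
    grind
  have hd : Perm.Disjoint (y :: L').formPerm (M ++ [x]).formPerm := by
    apply disj_formPerm
    simp only [List.cons_append, List.nodup_cons, List.nodup_append, List.mem_append,
        List.mem_cons] at h ⊢
    grind
  have e : (y :: L' ++ [x]).formPerm = swap x y * (y :: L').formPerm := by
    rw [← fp_rot _ _ hn2]; simp
  rw [fp_append L, fp_append M, fp_append (y :: L'), e]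
  calc _ = (L ++ [y]).formPerm * ((y :: L').formPerm * (M ++ [x]).formPerm) *
        (x :: M').formPerm := by simp only [mul_assoc]
    _ = ((L ++ [y]).formPerm * (M ++ [x]).formPerm) * (y :: L').formPerm *
        (x :: M').formPerm := by rw [hd.commute.eq]; simp only [mul_assoc]
    _ = _ := by rw [fp_merge _ _ _ _ hn1]; simp only [mul_assoc]

theorem three_cycles (L : List α) (a b c d e f : α)
    (h : (a :: b :: L ++ [c, d, e, f]).Nodup) :
    (a :: b :: L).formPerm * ([c, d].formPerm * [e, f].formPerm) =
      [f, a, b, c, d, e].formPerm * (f :: d :: b :: L).formPerm := by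
  have hm1 := fp_merge [a] [c] d b (by
    simp only [List.cons_append, List.nodup_cons, List.nodup_append, List.mem_append,
        List.mem_cons] at h ⊢
    grind)
  have hr := fp_rot [d] [a, b, c] (by
    simp only [List.cons_append, List.nodup_cons, List.nodup_append, List.mem_append,
        List.mem_cons] at h ⊢
    grind)
  have hm2 := fp_merge [a, b, c] [e] f d (by
    simp only [List.cons_append, List.nodup_cons, List.nodup_append, List.mem_append,
        List.mem_cons] at h ⊢
    grind)
  have hd : Perm.Disjoint (b :: L).formPerm [c, d].formPerm := by
    apply disj_formPerm
    simp only [List.cons_append, List.nodup_cons, List.nodup_append, List.mem_append,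
        List.mem_cons] at h ⊢
    grind
  have hd2 : Perm.Disjoint (b :: L).formPerm [e, f].formPerm := by
    apply disj_formPerm
    simp only [List.cons_append, List.nodup_cons, List.nodup_append, List.mem_append,
        List.mem_cons] at h ⊢
    grind
  have hd3 : Perm.Disjoint [d, b].formPerm [e, f].formPerm := by
    apply disj_formPerm
    simp only [List.cons_append, List.nodup_cons, List.nodup_append, List.mem_append,
        List.mem_cons] at h ⊢
    grind
  simp only [List.cons_append, List.nil_append] at hm1 hm2 hr
  rw [hr] at hm1
  calc _ = [a, b].formPerm * ((b :: L).formPerm * ([c, d].formPerm * [e, f].formPerm)) := by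
        simp [mul_assoc]
    _ = [a, b].formPerm * [c, d].formPerm * [e, f].formPerm * (b :: L).formPerm := by
        rw [(hd.commute.mul_right hd2.commute).eq]; simp only [mul_assoc]
    _ = [a, b, c, d].formPerm * ([d, b].formPerm * [e, f].formPerm) * (b :: L).formPerm := by
        rw [hm1, List.formPerm_pair d b]; simp only [mul_assoc]
    _ = ([a, b, c, d].formPerm * [e, f].formPerm) * [d, b].formPerm * (b :: L).formPerm := by
        rw [hd3.commute.eq]; simp only [mul_assoc]
    _ = _ := by
        rw [hm2]; simp only [mul_assoc, List.formPerm_cons_cons, List.formPerm_singleton, mul_one]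

theorem base_cert (σ : Perm α) (N : ℕ) (hN : N ≤ Fintype.card α) (Ls : List (List (Fin N)))
    (P Q : List (Fin N)) (h1 : Ls.flatten.Nodup ∧ ∀ l ∈ Ls, 2 ≤ l.length)
    (hP : P.Nodup ∧ P.length = 6) (hQ : Q.Nodup ∧ Q.length = 6)
    (h : (Ls.map List.formPerm).prod = P.formPerm * Q.formPerm)
    (ht : σ.cycleType = (Ls.map List.length : List ℕ)) : SixProd 2 σ := by
  obtain ⟨e⟩ : Nonempty (Fin N ↪ α) := by
    apply Function.Embedding.nonempty_of_card_le; simpa using hN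
  let E : Fin N ≃ Subtype (fun a => a ∈ Set.range e) := Equiv.ofInjective e e.injective
  classical
  have key : SixProd 2 (((Ls.map List.formPerm).prod).extendDomain E) := by
    refine ⟨[P.formPerm.extendDomain E, Q.formPerm.extendDomain E], rfl, ?_, ?_⟩
    · intro c hc
      simp only [List.mem_cons, List.not_mem_nil, or_false] at hc
      rcases hc with rfl | rfl
      · rw [Perm.cycleType_extendDomain, ct_formPerm hP.1 (by omega), hP.2]
      · rw [Perm.cycleType_extendDomain, ct_formPerm hQ.1 (by omega), hQ.2]
    · rw [h, ← Perm.extendDomain_mul]; simp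
  refine key.conj ?_
  rw [Perm.isConj_iff_cycleType_eq, Perm.cycleType_extendDomain, ct_prod _ h1.1 h1.2, ht]

set_option maxRecDepth 10000 in
theorem base_list (hα : 6 ≤ Fintype.card α) (σ : Perm α) (t : List ℕ) (ht : σ.cycleType = t)
    (hsort : t.Pairwise (· ≤ ·)) (h9 : t.sum ≤ 9) (h3 : t.length ≤ 3)
    (hev : Even (t.sum + t.length)) : SixProd 2 σ := by
  have h2 : ∀ n ∈ t, 2 ≤ n := fun n hn =>
    Perm.two_le_of_mem_cycleType (σ := σ) (by rw [ht]; exact hn)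
  have hsum := σ.sum_cycleType_le
  rw [ht, Multiset.sum_coe] at hsum
  rw [Nat.even_iff] at hev
  match t with
  | [] =>
    exact base_cert σ 6 (by omega) [] [0, 1, 2, 3, 4, 5] [3, 2, 1, 0, 5, 4] (by decide) (by decide) (by decide) (by decide) ht
  | [a] =>
    simp only [List.sum_cons, List.sum_nil, List.length_cons, List.length_nil] at hsum hev h9
    have := h2 a (by simp)
    obtain rfl | rfl | rfl | rfl : a = 3 ∨ a = 5 ∨ a = 7 ∨ a = 9 := by omega
    · exact base_cert σ 6 (by omega) [[1, 4, 3]] [0, 1, 2, 3, 4, 5] [1, 3, 0, 5, 4, 2] (by decide) (by decide) (by decide) (by decide) ht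
    · exact base_cert σ 6 (by omega) [[0, 5, 4, 2, 1]] [0, 1, 2, 3, 4, 5] [4, 1, 5, 3, 2, 0] (by decide) (by decide) (by decide) (by decide) ht
    · exact base_cert σ 7 (by omega) [[0, 2, 1, 4, 6, 3, 5]] [0, 1, 2, 3, 4, 5] [2, 0, 1, 3, 4, 6] (by decide) (by decide) (by decide) (by decide) ht
    · exact base_cert σ 9 (by omega) [[0, 7, 4, 8, 6, 1, 2, 3, 5]] [0, 1, 2, 3, 4, 5] [7, 3, 4, 8, 6, 0] (by decide) (by decide) (by decide) (by decide) ht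
  | [a, b] =>
    simp only [List.sum_cons, List.sum_nil, List.length_cons, List.length_nil] at hsum hev h9
    have := h2 a (by simp)
    have := h2 b (by simp)
    have hab : a ≤ b := by simp at hsort; omega
    obtain ⟨rfl, rfl⟩ | ⟨rfl, rfl⟩ | ⟨rfl, rfl⟩ | ⟨rfl, rfl⟩ | ⟨rfl, rfl⟩ | ⟨rfl, rfl⟩ :
        (a = 2 ∧ b = 2) ∨ (a = 2 ∧ b = 4) ∨ (a = 3 ∧ b = 3) ∨ (a = 2 ∧ b = 6) ∨ (a = 3 ∧ b = 5) ∨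
        (a = 4 ∧ b = 4) := by omega
    · exact base_cert σ 6 (by omega) [[0, 4], [2, 5]] [0, 1, 2, 3, 4, 5] [3, 2, 4, 5, 1, 0] (by decide) (by decide) (by decide) (by decide) ht
    · exact base_cert σ 6 (by omega) [[1, 3], [0, 5, 4, 2]] [0, 1, 2, 3, 4, 5] [1, 2, 5, 3, 0, 4] (by decide) (by decide) (by decide) (by decide) ht
    · exact base_cert σ 6 (by omega) [[0, 4, 3], [1, 5, 2]] [0, 1, 2, 3, 4, 5] [4, 2, 0, 3, 5, 1] (by decide) (by decide) (by decide) (by decide) ht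
    · exact base_cert σ 8 (by omega) [[2, 3], [0, 6, 7, 4, 1, 5]] [0, 1, 2, 3, 4, 5] [0, 6, 7, 3, 1, 4] (by decide) (by decide) (by decide) (by decide) ht
    · exact base_cert σ 8 (by omega) [[2, 6, 5], [0, 1, 3, 4, 7]] [0, 1, 2, 3, 4, 5] [4, 7, 5, 1, 2, 6] (by decide) (by decide) (by decide) (by decide) ht
    · exact base_cert σ 8 (by omega) [[0, 1, 3, 5], [2, 7, 4, 6]] [0, 1, 2, 3, 4, 5] [6, 1, 2, 7, 3, 4] (by decide) (by decide) (by decide) (by decide) ht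
  | [a, b, c] =>
    simp only [List.sum_cons, List.sum_nil, List.length_cons, List.length_nil] at hsum hev h9
    have := h2 a (by simp)
    have := h2 b (by simp)
    have := h2 c (by simp)
    have hab : a ≤ b ∧ b ≤ c := by simp at hsort; omega
    obtain ⟨rfl, rfl, rfl⟩ | ⟨rfl, rfl, rfl⟩ | ⟨rfl, rfl, rfl⟩ | ⟨rfl, rfl, rfl⟩ :
        (a = 2 ∧ b = 2 ∧ c = 3) ∨ (a = 2 ∧ b = 2 ∧ c = 5) ∨ (a = 2 ∧ b = 3 ∧ c = 4) ∨
        (a = 3 ∧ b = 3 ∧ c = 3) := by omega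
    · exact base_cert σ 7 (by omega) [[0, 1], [2, 6], [3, 5, 4]] [0, 1, 2, 3, 4, 5] [3, 4, 2, 6, 1, 5] (by decide) (by decide) (by decide) (by decide) ht
    · exact base_cert σ 9 (by omega) [[0, 5], [1, 2], [3, 4, 8, 6, 7]] [0, 1, 2, 3, 4, 5] [8, 6, 7, 2, 0, 4] (by decide) (by decide) (by decide) (by decide) ht
    · exact base_cert σ 9 (by omega) [[0, 6], [1, 2, 3], [4, 5, 8, 7]] [0, 1, 2, 3, 4, 5] [8, 7, 3, 0, 6, 5] (by decide) (by decide) (by decide) (by decide) ht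
    · exact base_cert σ 9 (by omega) [[0, 8, 6], [1, 2, 7], [3, 4, 5]] [0, 1, 2, 3, 4, 5] [0, 8, 6, 5, 2, 7] (by decide) (by decide) (by decide) (by decide) ht
  | a :: b :: c :: d :: t => simp at h3; omega

/-- the numerical condition -/
def Good (k : ℕ) (σ : Perm α) : Prop :=
  Even (σ.cycleType.sum + Multiset.card σ.cycleType + k) ∧ σ.cycleType.sum ≤ 4 * k + 1 ∧
    Multiset.card σ.cycleType ≤ k + 1

theorem base (hα : 6 ≤ Fintype.card α) (σ : Perm α) (h : Good 2 σ) : SixProd 2 σ := by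
  obtain ⟨h1, h2, h3⟩ := h
  have ht : σ.cycleType = (σ.cycleType.sort (· ≤ ·) : List ℕ) := (Multiset.sort_eq _ _).symm
  rw [ht] at h1 h2 h3
  rw [Multiset.sum_coe] at h1 h2
  rw [Multiset.coe_card] at h1 h3
  refine base_list hα σ _ ht (Multiset.pairwise_sort _ _) h2 h3 ?_
  rw [Nat.even_iff] at h1 ⊢
  omega

theorem split_list (l : List α) (p : ℕ) (hp : p < l.length) :
    ∃ L y L', l = L ++ y :: L' ∧ L.length = p := by
  refine ⟨l.take p, l[p], l.drop (p + 1), ?_, by simp; omega⟩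
  rw [← List.drop_eq_getElem_cons hp, List.take_append_drop]

theorem step_small (hα : 6 ≤ Fintype.card α) (k : ℕ) (hk : 2 ≤ k)
    (IH : ∀ τ : Perm α, Good k τ → SixProd k τ) (σ : Perm α) (h : Good (k + 1) σ)
    (hs : σ.cycleType.sum ≤ 6) : SixProd (k + 1) σ := by
  rw [Perm.sum_cycleType] at hs
  obtain ⟨S, hS, hS6⟩ := Finset.exists_superset_card_eq hs hα
  have hl : S.toList.length = 6 := by simp [hS6]
  have hc := ct_formPerm S.nodup_toList (by omega)
  rw [hl] at hc
  have hγs : S.toList.formPerm.support ⊆ S := by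
    have := List.support_formPerm_le S.toList
    simpa using this
  set γ := S.toList.formPerm with hγ
  have e : σ = γ * (γ⁻¹ * σ) := by group
  rw [e]
  refine SixProd.cons hc (IH _ ?_)
  have hsub : (γ⁻¹ * σ).support ⊆ S := by
    refine (Perm.support_mul_le _ _).trans ?_
    rw [Perm.support_inv]
    exact sup_le hγs hS
  have hcard := Finset.card_le_card hsub
  have h2 : Multiset.card (γ⁻¹ * σ).cycleType • 2 ≤ (γ⁻¹ * σ).cycleType.sum :=
    Multiset.card_nsmul_le_sum (fun x hx => Perm.two_le_of_mem_cycleType hx)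
  rw [← Perm.sum_cycleType] at hcard
  rw [smul_eq_mul] at h2
  refine ⟨?_, by omega, by omega⟩
  have sg : Perm.sign (γ⁻¹ * σ) = - Perm.sign σ := by
    rw [Perm.sign_mul, Perm.sign_inv, Perm.sign_of_cycleType γ, hc]
    simp [pow_succ]
  rw [Perm.sign_of_cycleType, Perm.sign_of_cycleType σ] at sg
  have h1 := h.1
  generalize (γ⁻¹ * σ).cycleType.sum + Multiset.card (γ⁻¹ * σ).cycleType = A at *
  generalize σ.cycleType.sum + Multiset.card σ.cycleType = B at *
  rcases Nat.even_or_odd A with hA | hA <;> rcases Nat.even_or_odd B with hB | hB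
  · rw [hA.neg_one_pow, hB.neg_one_pow] at sg; exact absurd sg (by decide)
  · rw [Nat.even_iff] at *; rw [Nat.odd_iff] at *; omega
  · rw [Nat.even_iff] at *; rw [Nat.odd_iff] at *; omega
  · rw [hA.neg_one_pow, hB.neg_one_pow] at sg; exact absurd sg (by decide)

theorem step_one (k : ℕ)
    (IH : ∀ τ : Perm α, Good k τ → SixProd k τ) (σ : Perm α) (h : Good (k + 1) σ)
    (r : ℕ) (hr : 7 ≤ r) (ht : σ.cycleType = ([r] : List ℕ)) : SixProd (k + 1) σ := by
  obtain ⟨h1, h2, h3⟩ := h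
  rw [ht] at h1 h2 h3
  simp only [Multiset.sum_coe, Multiset.coe_card, List.sum_cons, List.sum_nil, List.length_cons,
    List.length_nil, Nat.even_iff] at h1 h2 h3
  refine reduce σ _ ht ?_
  intro Ls hL hn
  obtain ⟨A, rfl⟩ : ∃ A, Ls = [A] := by
    rw [← List.length_eq_one_iff, ← List.length_map (f := List.length), hL]; rfl
  simp only [List.map_cons, List.map_nil, List.cons.injEq, and_true] at hL
  obtain ⟨L, y, L', rfl, hp⟩ := split_list A 5 (by omega)
  simp only [List.flatten_cons, List.flatten_nil, List.append_nil] at hn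
  simp only [List.length_append, List.length_cons] at hL
  simp only [List.map_cons, List.map_nil, List.prod_cons, List.prod_nil, mul_one]
  rw [fp_append]
  have n1 : (L ++ [y]).Nodup := by
    refine hn.sublist (List.Sublist.append (List.Sublist.refl _) ?_); simp
  have n2 : (y :: L').Nodup := hn.sublist (List.sublist_append_right _ _)
  refine SixProd.cons ?_ (IH _ ?_)
  · rw [ct_formPerm n1 (by simp; omega)]; simp [hp]
  · rw [Good, ct_formPerm n2 (by simp; omega)]
    simp only [Multiset.sum_singleton, Multiset.card_singleton, List.length_cons, Nat.even_iff]
    omega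

theorem step_two (k : ℕ)
    (IH : ∀ τ : Perm α, Good k τ → SixProd k τ) (σ : Perm α) (h : Good (k + 1) σ)
    (r s : ℕ) (t : List ℕ) (hr : 6 ≤ r + s) (ht : σ.cycleType = (r :: s :: t : List ℕ)) :
    SixProd (k + 1) σ := by
  obtain ⟨h1, h2, h3⟩ := h
  have hge : ∀ n ∈ (r :: s :: t), 2 ≤ n := fun n hn =>
    Perm.two_le_of_mem_cycleType (σ := σ) (by rw [ht]; exact hn)
  have hr2 := hge r (by simp)
  have hs2 := hge s (by simp)
  rw [ht] at h1 h2 h3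
  simp only [Multiset.sum_coe, Multiset.coe_card, List.sum_cons, List.length_cons,
    Nat.even_iff] at h1 h2 h3
  refine reduce σ _ ht ?_
  intro Ls hL hn
  match Ls with
  | [] => simp at hL
  | [A] => simp at hL
  | A :: B :: Ls =>
  simp only [List.map_cons, List.cons.injEq] at hL
  obtain ⟨hA, hB, hLs⟩ := hL
  obtain ⟨p, q, hpq, hp, hq⟩ : ∃ p q, p + q = 4 ∧ p < r ∧ q < s :=
    ⟨min 4 (r - 1), 4 - min 4 (r - 1), by omega, by omega, by omega⟩
  obtain ⟨L, y, L', rfl, hLp⟩ := split_list A p (by omega)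
  obtain ⟨M, x, M', rfl, hMq⟩ := split_list B q (by omega)
  simp only [List.flatten_cons] at hn
  simp only [List.length_append, List.length_cons] at hA hB
  simp only [List.map_cons, List.prod_cons]
  rw [← mul_assoc, two_cycles _ _ _ _ _ _ (by
    rw [← List.append_assoc] at hn; exact hn.sublist (List.sublist_append_left _ _)), mul_assoc]
  have n1 : (x :: L ++ y :: M).Nodup := by
    simp only [List.cons_append, List.nodup_cons, List.nodup_append, List.mem_append,
        List.mem_cons] at hn ⊢
    grind
  have n2 : ((y :: L' ++ x :: M') :: Ls).flatten.Nodup := by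
    simp only [List.flatten_cons, List.cons_append, List.nodup_cons, List.nodup_append,
      List.mem_append, List.mem_cons] at hn ⊢
    grind
  have hct := ct_prod _ n2 (by
    intro l hl
    rcases List.mem_cons.1 hl with rfl | hl
    · simp; omega
    · apply hge
      rw [← hLs]
      simp only [List.mem_cons, List.mem_map]
      exact Or.inr (Or.inr ⟨l, hl, rfl⟩))
  rw [List.map_cons, List.map_cons, List.prod_cons, hLs] at hct
  refine SixProd.cons ?_ (IH _ ?_)
  · rw [ct_formPerm n1 (by simp; omega)]
    congr 1; simp; omega
  · rw [Good, hct]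
    simp only [Multiset.sum_coe, Multiset.coe_card, List.sum_cons, List.length_cons,
      List.length_append, Nat.even_iff]
    omega

theorem step_three (k : ℕ)
    (IH : ∀ τ : Perm α, Good k τ → SixProd k τ) (σ : Perm α) (h : Good (k + 1) σ)
    (r : ℕ) (t : List ℕ) (hsum : r + 4 + t.sum ≤ 4 * k + 4)
    (ht : σ.cycleType = (r :: 2 :: 2 :: t : List ℕ)) :
    SixProd (k + 1) σ := by
  obtain ⟨h1, h2, h3⟩ := h
  have hge : ∀ n ∈ (r :: 2 :: 2 :: t), 2 ≤ n := fun n hn =>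
    Perm.two_le_of_mem_cycleType (σ := σ) (by rw [ht]; exact hn)
  have hr2 := hge r (by simp)
  rw [ht] at h1 h2 h3
  simp only [Multiset.sum_coe, Multiset.coe_card, List.sum_cons, List.length_cons,
    Nat.even_iff] at h1 h2 h3
  refine reduce σ _ ht ?_
  intro Ls hL hn
  match Ls with
  | [] => simp at hL
  | [A] => simp at hL
  | [A, B] => simp at hL
  | A :: B :: C :: Ls =>
  simp only [List.map_cons, List.cons.injEq] at hL
  obtain ⟨hA, hB, hC, hLs⟩ := hL
  obtain ⟨c, d, rfl⟩ := List.length_eq_two.1 hB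
  obtain ⟨e, f, rfl⟩ := List.length_eq_two.1 hC
  match A with
  | [] => simp at hA; omega
  | [a] => simp at hA; omega
  | a :: b :: L =>
  simp only [List.flatten_cons] at hn
  simp only [List.length_cons] at hA
  have n0 : (a :: b :: L ++ [c, d, e, f]).Nodup := by
    simp only [List.cons_append, List.nodup_cons, List.nodup_append, List.mem_append,
        List.mem_cons] at hn ⊢
    grind
  have n1 : [f, a, b, c, d, e].Nodup := by
    simp only [List.cons_append, List.nodup_cons, List.nodup_append, List.mem_append,
        List.mem_cons] at n0 ⊢
    grind
  have n2 : ((f :: d :: b :: L) :: Ls).flatten.Nodup := by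
    simp only [List.flatten_cons, List.cons_append, List.nodup_cons, List.nodup_append,
      List.mem_append, List.mem_cons] at hn ⊢
    grind
  have hct := ct_prod _ n2 (by
    intro l hl
    rcases List.mem_cons.1 hl with rfl | hl
    · simp
    · apply hge
      rw [← hLs]
      simp only [List.mem_cons, List.mem_map]
      exact Or.inr (Or.inr (Or.inr ⟨l, hl, rfl⟩)))
  rw [List.map_cons, List.map_cons, List.prod_cons, hLs] at hct
  have e3 := three_cycles L a b c d e f n0
  have e4 : (List.map List.formPerm ((a :: b :: L) :: [c, d] :: [e, f] :: Ls)).prod =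
      [f, a, b, c, d, e].formPerm *
        ((f :: d :: b :: L).formPerm * (List.map List.formPerm Ls).prod) := by
    rw [← mul_assoc, ← e3]
    simp only [List.map_cons, List.prod_cons, mul_assoc]
  rw [e4]
  refine SixProd.cons ?_ (IH _ ?_)
  · rw [ct_formPerm n1 (by simp)]; rfl
  · rw [Good, hct]
    simp only [Multiset.sum_coe, Multiset.coe_card, List.sum_cons, List.length_cons, Nat.even_iff]
    omega

theorem step (hα : 6 ≤ Fintype.card α) (k : ℕ) (hk : 2 ≤ k)
    (IH : ∀ τ : Perm α, Good k τ → SixProd k τ) (σ : Perm α) (h : Good (k + 1) σ) :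
    SixProd (k + 1) σ := by
  by_cases hs : σ.cycleType.sum ≤ 6
  · exact step_small hα k hk IH σ h hs
  have ht : σ.cycleType = (σ.cycleType.sort (· ≥ ·) : List ℕ) := (Multiset.sort_eq _ _).symm
  have hsort : (σ.cycleType.sort (· ≥ ·)).Pairwise (· ≥ ·) := Multiset.pairwise_sort _ _
  generalize σ.cycleType.sort (· ≥ ·) = t at ht hsort
  have hge : ∀ n ∈ t, 2 ≤ n := fun n hn =>
    Perm.two_le_of_mem_cycleType (σ := σ) (by rw [ht]; exact hn)
  rw [ht, Multiset.sum_coe] at hs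
  match t with
  | [] => simp at hs
  | [r] => exact step_one k IH σ h r (by simp at hs; omega) ht
  | r :: s :: t =>
  by_cases hrs : 6 ≤ r + s
  · exact step_two k IH σ h r s t hrs ht
  have hr2 := hge r (by simp)
  have hs2 := hge s (by simp)
  simp only [List.pairwise_cons, List.mem_cons, forall_eq_or_imp] at hsort
  have hs' : s = 2 := by omega
  subst hs'
  have ht2 : ∀ n ∈ t, n = 2 := fun n hn =>
    le_antisymm (hsort.2.1 n hn) (hge n (by simp [hn]))
  have hrep := List.eq_replicate_of_mem ht2
  match t with
  | [] => simp at hs; omega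
  | u :: t =>
  have hu : u = 2 := ht2 u (by simp)
  subst hu
  have hrep : t = List.replicate t.length 2 :=
    List.eq_replicate_of_mem (fun n hn => ht2 n (by simp [hn]))
  have hsum : t.sum = t.length * 2 := by
    conv_lhs => rw [hrep]
    simp
  have h3 := h.2.2
  rw [ht] at h3
  simp only [Multiset.coe_card, List.length_cons] at h3
  exact step_three k IH σ h r t (by omega) ht

theorem main_aux (hα : 6 ≤ Fintype.card α) (k : ℕ) (hk : 2 ≤ k) :
    ∀ σ : Perm α, Good k σ → SixProd k σ := by
  induction k, hk using Nat.le_induction with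
  | base => exact base hα
  | succ k hk ih => exact step hα k hk ih

end aux

theorem n_k_6_lemma1 (k n : ℕ) (hk : 2 ≤ k) (hke : Even k)
    (hn6 : 6 ≤ n) (hn : n ≤ 4 * k + 1)
    (σ : Equiv.Perm (Fin n)) (hσ : σ ∈ alternatingGroup (Fin n))
    (hns : σ.cycleFactorsFinset.card ≤ k + 1) :
    IsProdOfCycles n k 6 σ := by
  have hg : Good k σ := by
    refine ⟨?_, ?_, ?_⟩
    · rw [Perm.mem_alternatingGroup, Perm.sign_of_cycleType] at hσ
      refine Even.add ?_ hke
      by_contra hodd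
      rw [Nat.not_even_iff_odd] at hodd
      rw [hodd.neg_one_pow] at hσ
      exact absurd hσ (by decide)
    · have := σ.sum_cycleType_le
      simp only [Fintype.card_fin] at this
      omega
    · rw [Perm.cycleType_def]; simpa using hns
  obtain ⟨L, h1, h2, h3⟩ := main_aux (by simpa using hn6) k hk σ hg
  subst h1
  refine ⟨L.get, ?_, by rw [List.ofFn_get]; exact h3⟩
  intro i
  have hc := h2 (L.get i) (List.get_mem _ _)
  refine ⟨Perm.card_cycleType_eq_one.1 (by rw [hc]; rfl), ?_⟩
  rw [← Perm.sum_cycleType, hc]; rfl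
end

section
/- Let k ≥ 2 be even. Then n(k,6) ≥ 4k; that is, every element of the alternating group A_{4k} can be written as a product of k many 6-cycles of S_{4k}. -/
open Equiv

/-- list version of being a product of `k` six-cycles -/
def QP {n : ℕ} (k : ℕ) (σ : Perm (Fin n)) : Prop :=
  ∃ l : List (Perm (Fin n)), l.length = k ∧
    (∀ c ∈ l, c.IsCycle ∧ c.support.card = 6) ∧ σ = l.prod

lemma QP.toProd {n k : ℕ} {σ : Perm (Fin n)} (h : QP k σ) : IsProdOfCycles n k 6 σ := by
  obtain ⟨l, rfl, hl, rfl⟩ := h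
  refine ⟨fun i => l.get i, fun i => hl _ (List.get_mem _ _), ?_⟩
  rw [List.ofFn_get]

lemma QP.mul {n j k : ℕ} {σ τ : Perm (Fin n)} (h : QP j σ) (h' : QP k τ) :
    QP (j + k) (σ * τ) := by
  obtain ⟨l, rfl, hl, rfl⟩ := h
  obtain ⟨m, rfl, hm, rfl⟩ := h'
  refine ⟨l ++ m, by simp, ?_, by simp⟩
  intro c hc
  rcases List.mem_append.1 hc with h | h
  · exact hl c h
  · exact hm c h

lemma QP.one {n : ℕ} {c : Perm (Fin n)} (h : c.IsCycle) (h6 : c.support.card = 6) : QP 1 c :=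
  ⟨[c], rfl, by simpa using ⟨h, h6⟩, by simp⟩

lemma formPerm_card {α : Type*} [DecidableEq α] [Fintype α] (l : List α) (h : l.Nodup)
    (h2 : 2 ≤ l.length) : (l.formPerm).support.card = l.length := by
  rw [List.support_formPerm_of_nodup l h, List.toFinset_card_of_nodup h]
  rintro x rfl
  simp at h2

lemma wit8 {n : ℕ} (hn : 8 ≤ n) (σ : Perm (Fin n)) (Ls : List (List (Fin 8))) (a b : List (Fin 8))
    (h1 : ∀ l ∈ Ls, l.Nodup ∧ 2 ≤ l.length) (h2 : Ls.Pairwise (fun l m => ∀ x ∈ l, x ∉ m))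
    (ha : a.Nodup ∧ a.length = 6) (hb : b.Nodup ∧ b.length = 6)
    (hp : ∀ x, (Ls.map List.formPerm).prod x = (a.formPerm * b.formPerm) x)
    (h : σ.cycleType = (Ls.map List.length : List ℕ)) : QP 2 σ := by
  have hct : (a.formPerm * b.formPerm).cycleType = (Ls.map List.length : List ℕ) := by
    rw [Perm.cycleType_eq (Ls.map List.formPerm) (Equiv.ext hp)]
    · rw [List.map_map]
      congr 1
      apply List.map_congr_left
      intro l hl
      exact formPerm_card l (h1 l hl).1 (h1 l hl).2
    · intro c hc
      obtain ⟨l, hl, rfl⟩ := List.mem_map.1 hc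
      exact List.isCycle_formPerm (h1 l hl).1 (h1 l hl).2
    · rw [List.pairwise_map]
      refine h2.imp_of_mem ?_
      intro l m hl hm hd
      exact (List.formPerm_disjoint_iff (h1 l hl).1 (h1 m hm).1 (h1 l hl).2 (h1 m hm).2).2
        (fun x hx hx' => hd x hx hx')
  let e : Fin 8 ≃ {x : Fin n // x ∈ Set.range (Fin.castLE hn)} :=
    Equiv.ofInjective _ (Fin.castLE_injective hn)
  classical
  have hc : IsConj ((a.formPerm * b.formPerm).extendDomain e) σ := by
    rw [Perm.isConj_iff_cycleType_eq, Perm.cycleType_extendDomain, hct, h]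
  obtain ⟨π, rfl⟩ := isConj_iff.1 hc
  have key : ∀ l : List (Fin 8), l.Nodup ∧ l.length = 6 →
      QP 1 (π * l.formPerm.extendDomain e * π⁻¹) := by
    intro l hl
    refine QP.one ?_ ?_
    · exact ((List.isCycle_formPerm hl.1 (by omega)).extendDomain e).conj
    · rw [Perm.card_support_conj, Perm.card_support_extend_domain,
        formPerm_card l hl.1 (by omega), hl.2]
  have := (key a ha).mul (key b hb)
  convert this using 1
  rw [← Perm.extendDomain_mul]
  group

lemma wt {n : ℕ} (hn : 8 ≤ n) (σ : Perm (Fin n)) (h : σ.cycleType = ([] : List ℕ)) :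
    QP 2 σ :=
  wit8 hn σ [] [2, 5, 1, 7, 6, 0] [0, 6, 7, 1, 5, 2] (by decide) (by decide) (by decide) (by decide) (by decide) h

lemma wt3 {n : ℕ} (hn : 8 ≤ n) (σ : Perm (Fin n)) (h : σ.cycleType = ([3] : List ℕ)) :
    QP 2 σ :=
  wit8 hn σ [[0, 1, 2]] [7, 2, 0, 4, 5, 6] [0, 1, 7, 6, 5, 4] (by decide) (by decide) (by decide) (by decide) (by decide) h

lemma wt22 {n : ℕ} (hn : 8 ≤ n) (σ : Perm (Fin n)) (h : σ.cycleType = ([2, 2] : List ℕ)) :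
    QP 2 σ :=
  wit8 hn σ [[0, 1], [2, 3]] [2, 6, 0, 5, 3, 1] [0, 3, 1, 6, 2, 5] (by decide) (by decide) (by decide) (by decide) (by decide) h

lemma wt5 {n : ℕ} (hn : 8 ≤ n) (σ : Perm (Fin n)) (h : σ.cycleType = ([5] : List ℕ)) :
    QP 2 σ :=
  wit8 hn σ [[0, 1, 2, 3, 4]] [6, 0, 2, 3, 5, 1] [0, 5, 3, 4, 6, 1] (by decide) (by decide) (by decide) (by decide) (by decide) h

lemma wt42 {n : ℕ} (hn : 8 ≤ n) (σ : Perm (Fin n)) (h : σ.cycleType = ([4, 2] : List ℕ)) :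
    QP 2 σ :=
  wit8 hn σ [[0, 1, 2, 3], [4, 5]] [7, 5, 3, 0, 4, 2] [0, 1, 4, 7, 2, 5] (by decide) (by decide) (by decide) (by decide) (by decide) h

lemma wt33 {n : ℕ} (hn : 8 ≤ n) (σ : Perm (Fin n)) (h : σ.cycleType = ([3, 3] : List ℕ)) :
    QP 2 σ :=
  wit8 hn σ [[0, 1, 2], [3, 4, 5]] [2, 0, 5, 7, 4, 3] [0, 1, 3, 7, 5, 4] (by decide) (by decide) (by decide) (by decide) (by decide) h

lemma wt322 {n : ℕ} (hn : 8 ≤ n) (σ : Perm (Fin n)) (h : σ.cycleType = ([3, 2, 2] : List ℕ)) :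
    QP 2 σ :=
  wit8 hn σ [[0, 1, 2], [3, 4], [5, 6]] [5, 3, 2, 0, 1, 7] [1, 3, 4, 5, 6, 7] (by decide) (by decide) (by decide) (by decide) (by decide) h

lemma wt2222 {n : ℕ} (hn : 8 ≤ n) (σ : Perm (Fin n)) (h : σ.cycleType = ([2, 2, 2, 2] : List ℕ)) :
    QP 2 σ :=
  wit8 hn σ [[0, 1], [2, 3], [4, 5], [6, 7]] [2, 4, 1, 0, 6, 7] [0, 4, 5, 2, 3, 7] (by decide) (by decide) (by decide) (by decide) (by decide) h

lemma wt7 {n : ℕ} (hn : 8 ≤ n) (σ : Perm (Fin n)) (h : σ.cycleType = ([7] : List ℕ)) :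
    QP 2 σ :=
  wit8 hn σ [[0, 1, 2, 3, 4, 5, 6]] [5, 2, 3, 0, 7, 4] [0, 1, 5, 6, 3, 7] (by decide) (by decide) (by decide) (by decide) (by decide) h

lemma wt62 {n : ℕ} (hn : 8 ≤ n) (σ : Perm (Fin n)) (h : σ.cycleType = ([6, 2] : List ℕ)) :
    QP 2 σ :=
  wit8 hn σ [[0, 1, 2, 3, 4, 5], [6, 7]] [0, 4, 5, 1, 2, 6] [0, 5, 6, 7, 2, 3] (by decide) (by decide) (by decide) (by decide) (by decide) h

lemma wt53 {n : ℕ} (hn : 8 ≤ n) (σ : Perm (Fin n)) (h : σ.cycleType = ([5, 3] : List ℕ)) :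
    QP 2 σ :=
  wit8 hn σ [[0, 1, 2, 3, 4], [5, 6, 7]] [6, 4, 1, 0, 7, 5] [0, 4, 1, 2, 3, 6] (by decide) (by decide) (by decide) (by decide) (by decide) h

lemma wt44 {n : ℕ} (hn : 8 ≤ n) (σ : Perm (Fin n)) (h : σ.cycleType = ([4, 4] : List ℕ)) :
    QP 2 σ :=
  wit8 hn σ [[0, 1, 2, 3], [4, 5, 6, 7]] [1, 3, 2, 6, 7, 4] [0, 4, 5, 2, 1, 3] (by decide) (by decide) (by decide) (by decide) (by decide) h

lemma base_s19 {n : ℕ} (hn : 8 ≤ n) (σ : Perm (Fin n)) (hs : Perm.sign σ = 1)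
    (hc : σ.support.card ≤ 8) : QP 2 σ := by
  rw [Perm.sign_of_cycleType] at hs
  rw [← Perm.sum_cycleType] at hc
  have h2 : ∀ x ∈ σ.cycleType, 2 ≤ x := fun x hx => Perm.two_le_of_mem_cycleType hx
  have hs' : Even (σ.cycleType.sum + Multiset.card σ.cycleType) := by
    by_contra hcon
    rw [Nat.not_even_iff_odd] at hcon
    rw [hcon.neg_one_pow] at hs
    exact absurd hs (by decide)
  clear hs
  obtain ⟨l, hl⟩ : ∃ l : List ℕ, σ.cycleType = l := ⟨σ.cycleType.toList, by simp⟩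
  have fin : ∀ m : List ℕ, l.Perm m → σ.cycleType = (m : List ℕ) := by
    intro m hm
    rw [hl]
    exact Multiset.coe_eq_coe.2 hm
  rw [hl] at hc h2 hs'
  rcases l with _ | ⟨a, _ | ⟨b, _ | ⟨c, _ | ⟨d, _ | ⟨e, l⟩⟩⟩⟩⟩
  · exact wt hn σ hl
  all_goals simp at hc h2 hs'
  · obtain rfl | rfl | rfl : a = 3 ∨ a = 5 ∨ a = 7 := by
      rw [Nat.even_iff] at hs'; omega
    · exact wt3 hn σ hl
    · exact wt5 hn σ hl
    · exact wt7 hn σ hl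
  · have hab : a ≤ 6 ∧ b ≤ 6 := by omega
    obtain ⟨ha, hb⟩ := hab
    obtain ⟨h2a, h2b⟩ := h2
    rw [Nat.even_iff] at hs'
    interval_cases a <;> interval_cases b <;> first
      | (exfalso; omega)
      | exact wt22 hn σ (fin _ (by decide))
      | exact wt42 hn σ (fin _ (by decide))
      | exact wt33 hn σ (fin _ (by decide))
      | exact wt62 hn σ (fin _ (by decide))
      | exact wt53 hn σ (fin _ (by decide))
      | exact wt44 hn σ (fin _ (by decide))
  · obtain ⟨h2a, h2b, h2c⟩ := h2
    have hab : a ≤ 4 ∧ b ≤ 4 ∧ c ≤ 4 := by omega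
    obtain ⟨ha, hb, hc'⟩ := hab
    rw [Nat.even_iff] at hs'
    interval_cases a <;> interval_cases b <;> interval_cases c <;> first
      | (exfalso; omega)
      | exact wt322 hn σ (fin _ (by decide))
  · obtain ⟨rfl, rfl, rfl, rfl⟩ : a = 2 ∧ b = 2 ∧ c = 2 ∧ d = 2 := by omega
    exact wt2222 hn σ hl
  · exfalso; omega

lemma f6 {n : ℕ} {a b c d e f : Fin n} (h : [a, b, c, d, e, f].Nodup) :
    [a, b, c, d, e, f].formPerm a = b ∧ [a, b, c, d, e, f].formPerm b = c ∧
    [a, b, c, d, e, f].formPerm c = d ∧ [a, b, c, d, e, f].formPerm d = e ∧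
    [a, b, c, d, e, f].formPerm e = f :=
  ⟨List.formPerm_apply_lt_getElem _ h 0 (by simp), List.formPerm_apply_lt_getElem _ h 1 (by simp),
   List.formPerm_apply_lt_getElem _ h 2 (by simp), List.formPerm_apply_lt_getElem _ h 3 (by simp),
   List.formPerm_apply_lt_getElem _ h 4 (by simp)⟩

/-- a six-cycle `c` reducing the support of `σ` by at least `r` -/
def Red {n : ℕ} (r : ℕ) (σ : Perm (Fin n)) : Prop :=
  ∃ c : Perm (Fin n), c.IsCycle ∧ c.support.card = 6 ∧
    (c * σ).support.card + r ≤ σ.support.card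

lemma red_of {n : ℕ} (σ : Perm (Fin n)) (l : List (Fin n)) (h : l.Nodup) (h6 : l.length = 6)
    (hl : ∀ x ∈ l, σ x ≠ x) (R : List (Fin n)) (hR : R.Nodup)
    (hR' : ∀ x ∈ R, σ x ≠ x ∧ l.formPerm (σ x) = x) : Red R.length σ := by
  refine ⟨l.formPerm, List.isCycle_formPerm h (by omega), ?_, ?_⟩
  · rw [formPerm_card l h (by omega), h6]
  · have h1 : (l.formPerm * σ).support ⊆ σ.support \ R.toFinset := by
      intro x hx
      rw [Perm.mem_support, Perm.mul_apply] at hx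
      rw [Finset.mem_sdiff, Perm.mem_support, List.mem_toFinset]
      refine ⟨?_, fun hxR => hx (hR' x hxR).2⟩
      intro hfix
      rw [hfix] at hx
      exact hl x (List.mem_of_formPerm_apply_ne hx) hfix
    have h2 : R.toFinset ⊆ σ.support := by
      intro x hx
      rw [List.mem_toFinset] at hx
      exact Perm.mem_support.2 (hR' x hx).1
    have := Finset.card_le_card h1
    rw [Finset.card_sdiff_of_subset h2, List.toFinset_card_of_nodup hR] at this
    have h3 := Finset.card_le_card h2
    rw [List.toFinset_card_of_nodup hR] at h3
    omega

lemma pick {n : ℕ} (σ : Perm (Fin n)) (h : 9 ≤ σ.support.card) (l : List (Fin n))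
    (hl : l.length ≤ 8) : ∃ y, σ y ≠ y ∧ y ∉ l := by
  have : l.toFinset.card < σ.support.card := lt_of_le_of_lt (List.toFinset_card_le l) (by omega)
  obtain ⟨y, hy, hy'⟩ := Finset.exists_mem_notMem_of_card_lt_card this
  exact ⟨y, Perm.mem_support.1 hy, by simpa using hy'⟩

lemma even_inv {n : ℕ} (σ : Perm (Fin n)) (S : Finset (Fin n))
    (h : ∀ x ∈ S, σ x ∈ S ∧ σ x ≠ x ∧ σ (σ x) = x) : Even S.card := by
  have : ∑ x ∈ S, (1 : ZMod 2) = 0 :=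
    Finset.sum_involution (fun x _ => σ x) (fun _ _ => by decide)
      (fun x hx _ => (h x hx).2.1) (fun x hx => (h x hx).1) (fun x hx => (h x hx).2.2)
  rw [Finset.sum_const, nsmul_eq_mul, mul_one, ZMod.natCast_eq_zero_iff] at this
  exact even_iff_two_dvd.2 this

lemma step_s19 {n : ℕ} (σ : Perm (Fin n)) (h9 : 9 ≤ σ.support.card) :
    Red 4 σ ∨ (Red 3 σ ∧ Odd σ.support.card) ∨ (Red 3 σ ∧ ∀ x, σ (σ x) = x) := by
  have inj : ∀ x y, σ x = σ y → x = y := fun x y h => σ.injective h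
  by_cases h1 : ∃ x, σ x ≠ x ∧ σ (σ x) ≠ x ∧ σ (σ (σ x)) ≠ x ∧ σ (σ (σ (σ x))) ≠ x
  · left
    obtain ⟨x, hx1, hx2, hx3, hx4⟩ := h1
    obtain ⟨y, hy, hy'⟩ := pick σ h9 [σ (σ (σ (σ x))), σ (σ (σ x)), σ (σ x), σ x, x] (by simp)
    have hnd : [σ (σ (σ (σ x))), σ (σ (σ x)), σ (σ x), σ x, x, y].Nodup := by
      simp at hy' ⊢; grind
    obtain ⟨e1, e2, e3, e4, e5⟩ := f6 hnd
    refine red_of σ _ hnd rfl ?_ [σ (σ (σ x)), σ (σ x), σ x, x] ?_ ?_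
    · simp; grind
    · simp at hnd ⊢; grind
    · simp only [List.mem_cons, List.not_mem_nil, or_false]; grind
  push Not at h1
  by_cases h2 : ∃ x, σ x ≠ x ∧ σ (σ x) ≠ x ∧ σ (σ (σ x)) ≠ x
  · left
    obtain ⟨x, hx1, hx2, hx3⟩ := h2
    have hx4 := h1 x hx1 hx2 hx3
    obtain ⟨y, hy, hy'⟩ := pick σ h9 [σ (σ (σ x)), σ (σ x), σ x, x] (by simp)
    clear h1
    have hnd : [σ (σ (σ x)), σ (σ x), σ x, x, σ y, y].Nodup := by
      simp at hy' ⊢; grind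
    obtain ⟨e1, e2, e3, e4, e5⟩ := f6 hnd
    refine red_of σ _ hnd rfl ?_ [σ (σ x), σ x, x, y] ?_ ?_
    · simp; grind
    · simp at hnd ⊢; grind
    · simp only [List.mem_cons, List.not_mem_nil, or_false]; grind
  push Not at h2
  clear h1
  by_cases h3 : ∃ x, σ x ≠ x ∧ σ (σ x) ≠ x
  · obtain ⟨x, hx1, hx2⟩ := h3
    have hx3 := h2 x hx1 hx2
    by_cases h4 : ∃ y, y ∉ [σ (σ x), σ x, x] ∧ σ y ≠ y ∧ σ (σ y) ≠ y
    · left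
      obtain ⟨y, hy, hy1, hy2⟩ := h4
      have hy3 := h2 y hy1 hy2
      clear h2
      have hnd : [σ (σ x), σ x, x, σ (σ y), σ y, y].Nodup := by
        simp at hy ⊢; grind
      obtain ⟨e1, e2, e3, e4, e5⟩ := f6 hnd
      refine red_of σ _ hnd rfl ?_ [σ x, x, σ y, y] ?_ ?_
      · simp; grind
      · simp at hnd ⊢; grind
      · simp only [List.mem_cons, List.not_mem_nil, or_false]; grind
    · right; left
      push Not at h4
      clear h2
      constructor
      · obtain ⟨y, hy, hy'⟩ := pick σ h9 [σ (σ x), σ x, x] (by simp)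
        obtain ⟨z, hz, hz'⟩ := pick σ h9 [σ (σ x), σ x, x, σ y, y] (by simp)
        clear h4
        have hnd : [σ (σ x), σ x, x, σ y, y, z].Nodup := by
          simp at hy' hz' ⊢; grind
        obtain ⟨e1, e2, e3, e4, e5⟩ := f6 hnd
        refine red_of σ _ hnd rfl ?_ [σ x, x, y] ?_ ?_
        · simp; grind
        · simp at hnd ⊢; grind
        · simp only [List.mem_cons, List.not_mem_nil, or_false]; grind
      · have hnd : [σ (σ x), σ x, x].Nodup := by simp; grind
        have hsub : [σ (σ x), σ x, x].toFinset ⊆ σ.support := by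
          intro y hy
          rw [List.mem_toFinset] at hy
          rw [Perm.mem_support]
          simp at hy; grind
        have hev := even_inv σ (σ.support \ [σ (σ x), σ x, x].toFinset) (by
          intro y hy
          rw [Finset.mem_sdiff, List.mem_toFinset, Perm.mem_support] at hy
          have := h4 y hy.2 hy.1
          rw [Finset.mem_sdiff, List.mem_toFinset, Perm.mem_support]
          clear h4
          simp at hy ⊢
          grind)
        rw [Finset.card_sdiff_of_subset hsub, List.toFinset_card_of_nodup hnd] at hev
        simp only [List.length_cons, List.length_nil] at hev
        rw [Nat.even_iff] at hev
        rw [Nat.odd_iff]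
        omega
  · push Not at h3
    right; right
    have hinv : ∀ x, σ (σ x) = x := by
      intro x
      by_cases hx : σ x = x
      · rw [hx, hx]
      · exact h3 x hx
    refine ⟨?_, hinv⟩
    obtain ⟨x, hx, -⟩ := pick σ h9 [] (by simp)
    obtain ⟨y, hy, hy'⟩ := pick σ h9 [σ x, x] (by simp)
    obtain ⟨z, hz, hz'⟩ := pick σ h9 [σ x, x, σ y, y] (by simp)
    have ix := hinv x
    have iy := hinv y
    have iz := hinv z
    clear h2 h3 hinv
    have hnd : [σ x, x, σ y, y, σ z, z].Nodup := by
      simp at hy' hz' ⊢; grind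
    obtain ⟨e1, e2, e3, e4, e5⟩ := f6 hnd
    refine red_of σ _ hnd rfl ?_ [x, y, z] ?_ ?_
    · simp; grind
    · simp at hnd ⊢; grind
    · simp only [List.mem_cons, List.not_mem_nil, or_false]; grind

lemma small {n : ℕ} (hn : 8 ≤ n) (σ : Perm (Fin n)) :
    ∃ c : Perm (Fin n), c.IsCycle ∧ c.support.card = 6 ∧
      (c * σ).support.card ≤ max 6 σ.support.card := by
  obtain ⟨S, hS, hS'⟩ : ∃ S : Finset (Fin n), S.card = 6 ∧
      (S ∪ σ.support).card ≤ max 6 σ.support.card := by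
    rcases le_total 6 σ.support.card with h | h
    · obtain ⟨S, hS, hc⟩ := Finset.exists_subset_card_eq h
      exact ⟨S, hc, by rw [Finset.union_eq_right.2 hS]; simp⟩
    · obtain ⟨S, hS, hc⟩ := Finset.exists_superset_card_eq h (by simp; omega)
      exact ⟨S, hc, by rw [Finset.union_eq_left.2 hS]; simp [hc]⟩
  have hl : S.toList.length = 6 := by simp [hS]
  refine ⟨S.toList.formPerm, List.isCycle_formPerm S.nodup_toList (by omega), ?_, ?_⟩
  · rw [formPerm_card _ S.nodup_toList (by omega), hl]
  · refine le_trans (Finset.card_le_card ?_) hS'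
    refine (Perm.support_mul_le _ _).trans ?_
    refine sup_le_sup ?_ le_rfl
    have := List.support_formPerm_le S.toList
    simpa using this

lemma sign6 {n : ℕ} {c : Perm (Fin n)} (h : c.IsCycle) (h6 : c.support.card = 6) :
    Perm.sign c = -1 := by
  rw [h.sign, h6]; decide

lemma four {n : ℕ} (hn : 8 ≤ n) (σ : Perm (Fin n)) (h9 : 9 ≤ σ.support.card)
    (hinv : ∀ x, σ (σ x) = x) :
    ∃ τ : Perm (Fin n), QP 2 τ⁻¹ ∧ Perm.sign τ = 1 ∧
      (τ * σ).support.card + 8 ≤ σ.support.card := by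
  obtain ⟨x, hx, -⟩ := pick σ h9 [] (by simp)
  obtain ⟨y, hy, hy'⟩ := pick σ h9 [σ x, x] (by simp)
  obtain ⟨z, hz, hz'⟩ := pick σ h9 [σ x, x, σ y, y] (by simp)
  obtain ⟨w, hw, hw'⟩ := pick σ h9 [σ x, x, σ y, y, σ z, z] (by simp)
  have ix := hinv x
  have iy := hinv y
  have iz := hinv z
  have iw := hinv w
  clear hinv
  have inj : ∀ x y, σ x = σ y → x = y := fun x y h => σ.injective h
  have hnd : [σ x, x, σ y, y, σ z, z, σ w, w].Nodup := by
    simp at hy' hz' hw' ⊢; grind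
  let τ : Perm (Fin n) := swap x (σ x) * swap y (σ y) * swap z (σ z) * swap w (σ w)
  have hout : ∀ u, u ∉ [σ x, x, σ y, y, σ z, z, σ w, w] → τ u = u := by
    intro u hu
    simp only [List.mem_cons, List.not_mem_nil, or_false, not_or] at hu
    simp only [τ, Perm.mul_apply, swap_apply_def]
    grind
  have hin : ∀ u, u ∈ [σ x, x, σ y, y, σ z, z, σ w, w] → τ u = σ u := by
    intro u hu
    simp at hnd
    simp only [List.mem_cons, List.not_mem_nil, or_false] at hu
    simp only [τ, Perm.mul_apply, swap_apply_def]
    rcases hu with rfl | rfl | rfl | rfl | rfl | rfl | rfl | rfl <;> grind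
  have hsign : Perm.sign τ = 1 := by
    simp only [τ, map_mul, Perm.sign_swap (Ne.symm hx), Perm.sign_swap (Ne.symm hy),
      Perm.sign_swap (Ne.symm hz), Perm.sign_swap (Ne.symm hw)]
    decide
  have hcl : ∀ u, u ∈ [σ x, x, σ y, y, σ z, z, σ w, w] →
      σ u ∈ [σ x, x, σ y, y, σ z, z, σ w, w] ∧ σ u ≠ u ∧ σ (σ u) = u := by
    intro u hu
    simp only [List.mem_cons, List.not_mem_nil, or_false] at hu ⊢
    clear hin hout hsign hnd hy' hz' hw' inj
    rcases hu with rfl | rfl | rfl | rfl | rfl | rfl | rfl | rfl <;>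
      simp only [ix, iy, iz, iw, ne_eq, true_or, or_true, true_and, and_true] <;>
      first
      | assumption
      | exact Ne.symm (by assumption)
  refine ⟨τ, base_s19 hn _ (by rw [Perm.sign_inv, hsign]) ?_, hsign, ?_⟩
  · rw [Perm.support_inv]
    have : τ.support ⊆ [σ x, x, σ y, y, σ z, z, σ w, w].toFinset := by
      intro u hu
      rw [List.mem_toFinset]
      by_contra h
      exact Perm.mem_support.1 hu (hout u h)
    exact (Finset.card_le_card this).trans (List.toFinset_card_le _)
  · have h1 : (τ * σ).support ⊆ σ.support \ [σ x, x, σ y, y, σ z, z, σ w, w].toFinset := by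
      intro u hu
      rw [Perm.mem_support, Perm.mul_apply] at hu
      rw [Finset.mem_sdiff, Perm.mem_support, List.mem_toFinset]
      have h3 : u ∉ [σ x, x, σ y, y, σ z, z, σ w, w] := by
        intro h
        obtain ⟨p, q, r⟩ := hcl u h
        rw [hin _ p, r] at hu
        exact hu rfl
      refine ⟨?_, h3⟩
      intro hfix
      rw [hfix, hout u h3] at hu
      exact hu rfl
    have h2 : [σ x, x, σ y, y, σ z, z, σ w, w].toFinset ⊆ σ.support := by
      intro u hu
      rw [List.mem_toFinset] at hu
      exact Perm.mem_support.2 (hcl u hu).2.1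
    have h3 := Finset.card_le_card h1
    have h4 := Finset.card_le_card h2
    rw [Finset.card_sdiff_of_subset h2] at h3
    rw [List.toFinset_card_of_nodup hnd] at h3 h4
    simp only [List.length_cons, List.length_nil] at h3 h4
    omega

lemma inv_sign {n : ℕ} (σ : Perm (Fin n)) (hinv : ∀ x, σ (σ x) = x) :
    Perm.sign σ = (-1) ^ (σ.support.card / 2) := by
  have h2 : σ ^ 2 = 1 := by
    ext x; simp [pow_two, hinv]
  have hct := Perm.cycleType_of_pow_prime_eq_one (p := 2) h2
  have hsum := Perm.sum_cycleType σ
  rw [Perm.sign_of_cycleType', ← hsum]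
  rw [hct]
  simp

lemma main_ind {n : ℕ} (hn : 8 ≤ n) (k : ℕ) : 2 ≤ k → ∀ σ : Perm (Fin n),
    Perm.sign σ = (-1) ^ k → σ.support.card ≤ 4 * k → QP k σ := by
  induction k using Nat.strong_induction_on with
  | _ k ih =>
  intro hk σ hs hc
  rcases Nat.eq_or_lt_of_le hk with rfl | hk3
  · exact base_s19 hn σ (by rw [hs]; decide) hc
  obtain ⟨m, rfl⟩ : ∃ m, k = m + 1 := ⟨k - 1, by omega⟩
  have use1 : ∀ c : Perm (Fin n), c.IsCycle → c.support.card = 6 →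
      (c * σ).support.card ≤ 4 * m → QP (m + 1) σ := by
    intro c h1 h6 hcs
    have := ih m (by omega) (by omega) (c * σ)
      (by rw [map_mul, sign6 h1 h6, hs, pow_succ]; simp) hcs
    have h := (QP.one (c := c⁻¹) h1.inv (by rw [Perm.support_inv, h6])).mul this
    rw [inv_mul_cancel_left, add_comm] at h
    exact h
  by_cases hsm : σ.support.card ≤ 4 * m
  · obtain ⟨c, h1, h6, h⟩ := small hn σ
    exact use1 c h1 h6 (h.trans (max_le (by omega) hsm))
  push Not at hsm
  rcases step_s19 σ (by omega) with ⟨c, h1, h6, h⟩ | ⟨⟨c, h1, h6, h⟩, hodd⟩ | ⟨⟨c, h1, h6, h⟩, hinv⟩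
  · exact use1 c h1 h6 (by omega)
  · rw [Nat.odd_iff] at hodd
    exact use1 c h1 h6 (by omega)
  · by_cases hfull : σ.support.card = 4 * m + 4
    · have hsg := inv_sign σ hinv
      rw [hfull, show (4 * m + 4) / 2 = 2 * (m + 1) by omega, pow_mul, hs] at hsg
      have hev : Even (m + 1) := by
        by_contra hcon
        rw [Nat.not_even_iff_odd] at hcon
        rw [hcon.neg_one_pow] at hsg
        simp at hsg
      obtain ⟨j, rfl⟩ : ∃ j, m = j + 1 := ⟨m - 1, by omega⟩
      rw [Nat.even_iff] at hev
      obtain ⟨τ, hq, ht, hcard⟩ := four hn σ (by omega) hinv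
      have := ih j (by omega) (by omega) (τ * σ)
        (by rw [map_mul, ht, hs, one_mul, pow_succ, pow_succ]; simp) (by omega)
      have h := hq.mul this
      rw [inv_mul_cancel_left, add_comm] at h
      exact h
    · exact use1 c h1 h6 (by omega)

theorem lower_bound_n_k_6 (k : ℕ) (hk : 2 ≤ k) (hke : Even k) :
    ∀ σ ∈ alternatingGroup (Fin (4 * k)), IsProdOfCycles (4 * k) k 6 σ := by
  intro σ hσ
  refine (main_ind (by omega) k hk σ ?_ ?_).toProd
  · rw [hke.neg_one_pow]; exact Perm.mem_alternatingGroup.1 hσ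
  · exact (Finset.card_le_univ _).trans (by simp)
end
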